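/- Let N be a nonnegative integer and let η ∈ ℝ_N. Then for each i ∈ {0,1,2,3}, Sklyanin's operator S_i is self-adjoint for the Sklyanin pairing: ⟨S_i f, g⟩ = ⟨f, S_i g⟩ for all f, g ∈ Θ_N. If instead η ∈ 𝕀_N, then each S_i is skew-adjoint: ⟨S_i f, g⟩ = −⟨f, S_i g⟩ for all f, g ∈ Θ_N. -/

import Mathlib

noncomputable section
open Complex MeasureTheory

def cπ : ℂ := Real.pi

/-- Jacobi's first theta function θ₁(x|τ). -/
def θf (τ x : ℂ) : ℂ :=
  I * ∑' n : ℤ, (-1 : ℂ) ^ n *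
    Complex.exp (cπ * I * τ * ((n : ℂ) - 1/2)^2 + cπ * I * (2*(n : ℂ) - 1) * x)

/-- The space Θ_N of even theta functions of order 2N. -/
def ThetaSp (τ : ℂ) (N : ℕ) (f : ℂ → ℂ) : Prop :=
  Differentiable ℂ f ∧ (∀ x, f (x + 1) = f x) ∧
  (∀ x, f (x + τ) = Complex.exp (-2*cπ*I*N*(2*x + τ)) * f x) ∧
  (∀ x, f (-x) = f x)

/-- Sklyanin's weight function M(u,v). -/
def Mw (τ η : ℂ) (N : ℕ) (u v : ℂ) : ℂ :=
  θf τ (2*u) * θf τ (2*v) /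
    (Complex.exp (2*cπ*I*u*(N+2)) *
      ∏ k ∈ Finset.range (N+2),
        (θf τ (u + v + (2*(k:ℂ) - N - 1)*η + 1/2 + τ/2) *
         θf τ (u - v + (2*(k:ℂ) - N - 1)*η + 1/2 + τ/2)))

/-- Sklyanin's invariant pairing, with τ = t * I. -/
def pairing (τ η : ℂ) (t : ℝ) (N : ℕ) (f g : ℂ → ℂ) : ℂ :=
  ∫ y in (0:ℝ)..t, ∫ x in (0:ℝ)..(1:ℝ),
    f (x + y*I) * (starRingEnd ℂ) (g (x + y*I)) *
      Mw τ η N (x + y*I) ((starRingEnd ℂ) (x + y*I))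

/-- The numerator defining the difference operator Δ(a). -/
def ΔRHS (τ η : ℂ) (N : ℕ) (a₁ a₂ a₃ a₄ : ℂ) (f : ℂ → ℂ) (x : ℂ) : ℂ :=
  θf τ (x + a₁ - N*η/2) * θf τ (x + a₂ - N*η/2) * θf τ (x + a₃ - N*η/2) *
    θf τ (x + a₄ - N*η/2) * f (x + η)
  - θf τ (x - a₁ + N*η/2) * θf τ (x - a₂ + N*η/2) * θf τ (x - a₃ + N*η/2) *
    θf τ (x - a₄ + N*η/2) * f (x - η)

/-- The involution σ on Θ_N. -/
def σop (τ : ℂ) (N : ℕ) (f : ℂ → ℂ) (x : ℂ) : ℂ :=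
  Complex.exp (2*cπ*I*N*(1/4 + τ/4 + x)) * f (x + 1/2 + τ/2)

/-- q-Pochhammer infinite product (a;p)_∞. -/
def qPoch (a p : ℂ) : ℂ := ∏' j : ℕ, (1 - a * p^j)

/-- The constant C of Theorem 3.2. -/
def Cconst (τ η : ℂ) (N : ℕ) : ℂ :=
  2*η * Complex.exp (2*cπ*I*τ*(3/8)) /
    (θf τ (2*(N+1)*η) *
      (qPoch (Complex.exp (2*cπ*I*τ)) (Complex.exp (2*cπ*I*τ)))^3)

/-- The kernel K(u,w). -/
def Kk (τ η : ℂ) (N : ℕ) (u w : ℂ) : ℂ :=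
  Complex.exp (2*cπ*I*u*(N:ℂ)) *
  ∏ k ∈ Finset.range N,
    (θf τ (u + w + (2*(k:ℂ) - N + 1)*η + 1/2 + τ/2) *
     θf τ (u - w + (2*(k:ℂ) - N + 1)*η + 1/2 + τ/2))

/-- The basis functions e_k^N(x;a,b). -/
def ekN (τ η : ℂ) (N k : ℕ) (a b : ℂ) (x : ℂ) : ℂ :=
  (∏ j ∈ Finset.range k, (θf τ (a + x + 2*(j:ℂ)*η) * θf τ (a - x + 2*(j:ℂ)*η))) *
  (∏ j ∈ Finset.range (N - k), (θf τ (b + x + 2*(j:ℂ)*η) * θf τ (b - x + 2*(j:ℂ)*η)))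

/-- Elliptic number [x] = θ(2ηx). -/
def ell (τ η x : ℂ) : ℂ := θf τ (2*η*x)

/-- Elliptic shifted factorial [x]_k. -/
def ellFac (τ η x : ℂ) (k : ℕ) : ℂ := ∏ j ∈ Finset.range k, ell τ η (x + j)


/-- Sklyanin's coefficient functions s₀, s₁, s₂, s₃. -/
def sfun (τ η : ℂ) (i : Fin 4) (x : ℂ) : ℂ :=
  if i = 0 then θf τ η * θf τ (2*x)
  else if i = 1 then θf τ (η + 1/2) * θf τ (2*x + 1/2)
  else if i = 2 then
    Complex.exp (cπ*I*(1/2 + τ/2 + η + 2*x)) * θf τ (η + 1/2 + τ/2) * θf τ (2*x + 1/2 + τ/2)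
  else -Complex.exp (cπ*I*(τ/2 + η + 2*x)) * θf τ (η + τ/2) * θf τ (2*x + τ/2)

/-- The numerator defining Sklyanin's operator S_i. -/
def SRHS (τ η : ℂ) (N : ℕ) (i : Fin 4) (f : ℂ → ℂ) (x : ℂ) : ℂ :=
  sfun τ η i (x - N*η/2) * f (x + η) - sfun τ η i (-x - N*η/2) * f (x - η)

open scoped Real Topology

/-- Division lemma: if `d` has simple zeros and `T` vanishes on them, then `d` divides `T`. -/
lemma sk_div (d T : ℂ → ℂ) (hd : Differentiable ℂ d) (hT : Differentiable ℂ T)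
    (hs : ∀ z, d z = 0 → deriv d z ≠ 0) (hz : ∀ z, d z = 0 → T z = 0) :
    ∃ q : ℂ → ℂ, Differentiable ℂ q ∧ ∀ z, T z = d z * q z := by
  classical
  refine ⟨fun z => if d z = 0 then deriv T z / deriv d z else T z / d z, ?_, ?_⟩
  · intro z0
    by_cases h0 : d z0 = 0
    · have hD : ∀ F : ℂ → ℂ, Differentiable ℂ F → DifferentiableAt ℂ (dslope F z0) z0 := by
        intro F hF
        have := (Complex.differentiableOn_dslope (f := F) (s := Set.univ) (c := z0)
          Filter.univ_mem).2 hF.differentiableOn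
        exact this.differentiableAt Filter.univ_mem
      have hdd := hD d hd
      have hne : dslope d z0 z0 ≠ 0 := by rw [dslope_same]; exact hs z0 h0
      have hev : ∀ᶠ z in 𝓝 z0, dslope d z0 z ≠ 0 := hdd.continuousAt.eventually_ne hne
      have : DifferentiableAt ℂ (fun z => dslope T z0 z / dslope d z0 z) z0 :=
        (hD T hT).div hdd hne
      refine this.congr_of_eventuallyEq ?_
      filter_upwards [hev] with z hzne
      by_cases hzz : z = z0
      · subst hzz
        simp [h0]
      · have e1 : d z = (z - z0) * dslope d z0 z := by
          rw [← smul_eq_mul, sub_smul_dslope, h0, sub_zero]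
        have e2 : T z = (z - z0) * dslope T z0 z := by
          rw [← smul_eq_mul, sub_smul_dslope, hz z0 h0, sub_zero]
        have hz0 : z - z0 ≠ 0 := sub_ne_zero.2 hzz
        have : d z ≠ 0 := by rw [e1]; exact mul_ne_zero hz0 hzne
        simp only [this, if_false]
        rw [e1, e2, mul_div_mul_left _ _ hz0]
    · have hev : ∀ᶠ z in 𝓝 z0, d z ≠ 0 := (hd z0).continuousAt.eventually_ne h0
      refine ((hT z0).div (hd z0) h0).congr_of_eventuallyEq ?_
      filter_upwards [hev] with z hz
      simp [hz]
  · intro z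
    by_cases h0 : d z = 0
    · simp [h0, hz z h0]
    · simp only [h0, if_false]
      field_simp

lemma sk_simple_mul (f g : ℂ → ℂ) (hf : Differentiable ℂ f) (hg : Differentiable ℂ g)
    (hsf : ∀ z, f z = 0 → deriv f z ≠ 0) (hsg : ∀ z, g z = 0 → deriv g z ≠ 0)
    (hdis : ∀ z, f z = 0 → g z ≠ 0) :
    ∀ z, f z * g z = 0 → deriv (fun z => f z * g z) z ≠ 0 := by
  intro z hz
  rw [deriv_fun_mul (hf z) (hg z)]
  rcases mul_eq_zero.1 hz with h | h
  · rw [h]; simpa using ⟨hsf z h, hdis z h⟩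
  · have : f z ≠ 0 := fun h' => hdis z h' h
    rw [h]; simpa using ⟨this, hsg z h⟩

lemma sk_simple_comp (f : ℂ → ℂ) (hf : Differentiable ℂ f)
    (hsf : ∀ z, f z = 0 → deriv f z ≠ 0) (a b : ℂ) (ha : a ≠ 0) :
    ∀ z, f (a * z + b) = 0 → deriv (fun z => f (a * z + b)) z ≠ 0 := by
  intro z hz
  have h1 : HasDerivAt (fun z => a * z + b) a z := by
    simpa using ((hasDerivAt_id z).const_mul a).add_const b
  have := (hf (a * z + b)).hasDerivAt.comp z h1
  rw [show (fun z => f (a * z + b)) = f ∘ (fun z => a * z + b) from rfl, this.deriv]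
  exact mul_ne_zero (hsf _ hz) ha

/-- lattice induction -/
lemma sk_lat (τ : ℂ) (P : ℂ → Prop) (h1 : ∀ x, P (x + 1) ↔ P x) (h2 : ∀ x, P (x + τ) ↔ P x)
    (m k : ℤ) (x : ℂ) : P (x + m + k * τ) ↔ P x := by
  have hk : ∀ (k : ℤ) x, P (x + k * τ) ↔ P x := by
    intro k
    induction k with
    | zero => intro x; simp
    | succ k ih =>
      intro x
      rw [← ih x, ← h2 (x + ((k:ℤ):ℂ) * τ)]
      push_cast; ring_nf
    | pred k ih =>
      intro x
      rw [← ih x, ← h2 (x + (((-(k:ℤ) - 1 : ℤ)) : ℂ) * τ)]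
      push_cast; ring_nf
  have hm : ∀ (m : ℤ) x, P (x + m) ↔ P x := by
    intro m
    induction m with
    | zero => intro x; simp
    | succ k ih =>
      intro x
      rw [← ih x, ← h1 (x + ((k:ℤ):ℂ))]
      push_cast; ring_nf
    | pred k ih =>
      intro x
      rw [← ih x, ← h1 (x + (((-(k:ℤ) - 1 : ℤ)) : ℂ))]
      push_cast; ring_nf
  rw [hk, hm]

/-- an entire function with periods `1` and `t I` is constant. -/
lemma sk_liouville (t : ℝ) (ht : 0 < t) (q : ℂ → ℂ) (hq : Differentiable ℂ q)
    (h1 : ∀ x, q (x + 1) = q x) (h2 : ∀ x, q (x + t * I) = q x) (z w : ℂ) : q z = q w := by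
  apply hq.apply_eq_apply_of_bounded
  have hK : IsCompact (Set.Icc (0:ℝ) 1 ×ℂ Set.Icc (0:ℝ) t) := isCompact_Icc.reProdIm isCompact_Icc
  refine ((hK.image hq.continuous).isBounded).subset ?_
  rintro _ ⟨x, rfl⟩
  set k : ℤ := ⌊x.im / t⌋
  set m : ℤ := ⌊x.re⌋
  refine ⟨x + ((-m : ℤ) : ℂ) + ((-k : ℤ) : ℂ) * (t * I), ?_, ?_⟩
  · rw [Complex.mem_reProdIm]
    have a1 := Int.floor_le x.re
    have a2 := (Int.lt_floor_add_one x.re).le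
    have b1 := Int.floor_le (x.im / t)
    have b2 := (Int.lt_floor_add_one (x.im / t)).le
    rw [le_div_iff₀ ht] at b1
    rw [div_le_iff₀ ht] at b2
    constructor
    · simp; constructor <;> [exact a1; linarith]
    · simp; constructor <;> [exact b1; linarith]
  · exact (sk_lat (t * I) (fun y => q y = q x) (fun y => by simp only [h1]) (fun y => by simp only [h2]) _ _ x).2 rfl

lemma sk_const (t : ℝ) (ht : 0 < t) (d T : ℂ → ℂ) (hd : Differentiable ℂ d)
    (hT : Differentiable ℂ T) (hs : ∀ z, d z = 0 → deriv d z ≠ 0) (hz : ∀ z, d z = 0 → T z = 0)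
    (hdense : Dense {z | d z ≠ 0})
    (M1 M2 : ℂ → ℂ) (hM1 : ∀ z, M1 z ≠ 0) (hM2 : ∀ z, M2 z ≠ 0)
    (d1 : ∀ z, d (z + 1) = M1 z * d z) (T1 : ∀ z, T (z + 1) = M1 z * T z)
    (d2 : ∀ z, d (z + t * I) = M2 z * d z) (T2 : ∀ z, T (z + t * I) = M2 z * T z) :
    ∃ C : ℂ, ∀ z, T z = C * d z := by
  obtain ⟨q, hq, hqe⟩ := sk_div d T hd hT hs hz
  have key : ∀ (ω : ℂ) (M : ℂ → ℂ), (∀ z, M z ≠ 0) → (∀ z, d (z + ω) = M z * d z) →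
      (∀ z, T (z + ω) = M z * T z) → ∀ z, q (z + ω) = q z := by
    intro ω M hM hdω hTω
    have : (fun z => q (z + ω)) = q := by
      refine Continuous.ext_on hdense (by have := hq.continuous; fun_prop) hq.continuous ?_
      intro z hz
      have h := hTω z
      rw [hqe, hqe, hdω] at h
      have hne : M z * d z ≠ 0 := mul_ne_zero (hM z) hz
      apply mul_left_cancel₀ hne
      simp only
      rw [h]; ring
    exact fun z => congrFun this z
  refine ⟨q 0, fun z => ?_⟩
  rw [hqe, sk_liouville t ht q hq (key 1 M1 hM1 d1 T1) (key _ M2 hM2 d2 T2) z 0, mul_comm]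

/-- contour shift for a periodic function -/
lemma sk_shift (K : ℂ → ℂ) (h : ℝ) (hper : ∀ z, K (z + 1) = K z)
    (hd : ∀ (b s : ℝ), s ∈ Set.uIcc 0 h → DifferentiableAt ℂ K (b + s * I)) :
    ∫ b in (0:ℝ)..1, K b = ∫ b in (0:ℝ)..1, K (b + h * I) := by
  have := integral_boundary_rect_eq_zero_of_differentiableOn K 0 (1 + h * I) (by
    intro z hz
    rw [Complex.mem_reProdIm] at hz
    have := hd z.re z.im (by simpa using hz.2)
    rw [re_add_im] at this
    exact this.differentiableWithinAt)
  simp at this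
  have e : ∀ y : ℝ, K (1 + y * I) = K (y * I) := fun y => by rw [add_comm, hper]
  simp only [e] at this
  linear_combination this

lemma sk_swap (F : ℝ → ℝ → ℂ) (hF : Continuous (Function.uncurry F)) :
    ∫ b in (0:ℝ)..1, ∫ a in (0:ℝ)..1, F a b = ∫ a in (0:ℝ)..1, ∫ b in (0:ℝ)..1, F a b := by
  simp only [intervalIntegral.integral_of_le zero_le_one]
  rw [MeasureTheory.integral_integral_swap]
  rw [Measure.prod_restrict]
  have : IntegrableOn (Function.uncurry fun b a => F a b) (Set.Icc 0 1 ×ˢ Set.Icc 0 1) (volume.prod volume) := by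
    apply ContinuousOn.integrableOn_compact (isCompact_Icc.prod isCompact_Icc)
    exact (hF.comp continuous_swap).continuousOn
  exact this.mono_set (Set.prod_mono Set.Ioc_subset_Icc_self Set.Ioc_subset_Icc_self)

def skA (p w : ℂ) : ℂ := ∏' n : ℕ, (1 + w * p ^ n)

lemma skA_summable (p : ℂ) (hp : ‖p‖ < 1) (w : ℂ) : Summable fun n : ℕ => ‖w * p ^ n‖ := by
  simp only [norm_mul, norm_pow]
  exact (summable_geometric_of_lt_one (norm_nonneg _) hp).mul_left _

lemma skA_step (p : ℂ) (hp : ‖p‖ < 1) (w : ℂ) : skA p w = (1 + w) * skA p (p * w) := by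
  have hm : ∀ w, Multipliable fun n : ℕ => (1 + w * p ^ n) :=
    fun w => multipliable_one_add_of_summable (skA_summable p hp w)
  unfold skA
  rw [tprod_eq_zero_mul' (f := fun n : ℕ => (1 + w * p ^ n))]
  · simp only [pow_zero, mul_one]
    congr 1
    apply tprod_congr; intro n; ring
  · have := hm (p * w)
    refine this.congr ?_
    intro n; ring

lemma skA_ne (p : ℂ) (hp : ‖p‖ < 1) (w : ℂ) (h : ∀ n : ℕ, 1 + w * p ^ n ≠ 0) : skA p w ≠ 0 :=
  tprod_one_add_ne_zero_of_summable h (skA_summable p hp w)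

lemma skA_diff (p : ℂ) (hp : ‖p‖ < 1) : Differentiable ℂ (skA p) := by
  intro w0
  have hu : Summable fun n : ℕ => (‖w0‖ + 1) * ‖p‖ ^ n :=
    (summable_geometric_of_lt_one (norm_nonneg _) hp).mul_left _
  have h := Summable.hasProdLocallyUniformlyOn_nat_one_add (f := fun n w => w * p ^ n)
    (K := Metric.ball w0 1) Metric.isOpen_ball hu (by
      refine Filter.Eventually.of_forall fun n w hw => ?_
      simp only [norm_mul, norm_pow]
      gcongr
      have := norm_sub_norm_le w w0
      rw [Metric.mem_ball, dist_eq_norm] at hw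
      linarith) (fun n => by fun_prop)
  have h2 : DifferentiableOn ℂ (skA p) (Metric.ball w0 1) := by
    have h3 := hasProdLocallyUniformlyOn_iff_tendstoLocallyUniformlyOn.1 h
    refine h3.differentiableOn (Filter.Eventually.of_forall fun s => ?_) Metric.isOpen_ball
    fun_prop
  exact h2.differentiableAt (Metric.isOpen_ball.mem_nhds (Metric.mem_ball_self one_pos))

/-- product side of the Jacobi triple product -/
def skP (τ x : ℂ) : ℂ :=
  skA (cexp (2 * π * I * τ)) (cexp (π * I * τ + 2 * π * I * x)) *
  skA (cexp (2 * π * I * τ)) (cexp (π * I * τ - 2 * π * I * x))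


lemma sk_norm_p (t : ℝ) (ht : 0 < t) : ‖cexp (2 * π * I * (t * I))‖ < 1 := by
  rw [Complex.norm_exp]
  have : (2 * π * I * (t * I) : ℂ).re = -(2 * π * t) := by
    simp [mul_assoc]
  rw [this, Real.exp_lt_one_iff]
  have := Real.pi_pos
  nlinarith [mul_pos this ht]

lemma skP_diff (t : ℝ) (ht : 0 < t) : Differentiable ℂ (skP (t * I)) := by
  have h := skA_diff _ (sk_norm_p t ht)
  unfold skP
  intro x
  refine DifferentiableAt.mul ?_ ?_
  · exact (h _).comp x (by fun_prop)
  · exact (h _).comp x (by fun_prop)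

lemma skP_add_one (τ x : ℂ) : skP τ (x + 1) = skP τ x := by
  unfold skP
  have e1 : cexp (π * I * τ + 2 * π * I * (x + 1)) = cexp (π * I * τ + 2 * π * I * x) := by
    rw [← Complex.exp_periodic (π * I * τ + 2 * π * I * x)]; congr 1; ring
  have e2 : cexp (π * I * τ - 2 * π * I * (x + 1)) = cexp (π * I * τ - 2 * π * I * x) := by
    rw [← Complex.exp_periodic.sub_eq (π * I * τ - 2 * π * I * x)]; congr 1; ring
  rw [e1, e2]

lemma skP_add_tau (t : ℝ) (ht : 0 < t) (x : ℂ) :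
    skP (t * I) (x + t * I) = cexp (-π * I * (t * I + 2 * x)) * skP (t * I) x := by
  have hp := sk_norm_p t ht
  unfold skP
  set τ : ℂ := t * I
  set p := cexp (2 * π * I * τ)
  have e1 : cexp (π * I * τ + 2 * π * I * (x + τ)) = p * cexp (π * I * τ + 2 * π * I * x) := by
    rw [← Complex.exp_add]; congr 1; ring
  have e2 : p * cexp (π * I * τ - 2 * π * I * (x + τ)) = cexp (π * I * τ - 2 * π * I * x) := by
    rw [← Complex.exp_add]; congr 1; ring
  rw [e1, skA_step p hp (cexp (π * I * τ - 2 * π * I * (x + τ))), e2,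
    skA_step p hp (cexp (π * I * τ + 2 * π * I * x))]
  have e3 : cexp (π * I * τ - 2 * π * I * (x + τ)) = cexp (-π * I * (τ + 2 * x)) := by
    congr 1; ring
  have e4 : cexp (-π * I * (τ + 2 * x)) * cexp (π * I * τ + 2 * π * I * x) = 1 := by
    rw [← Complex.exp_add, ← Complex.exp_zero]; congr 1; ring
  rw [e3]
  linear_combination (-skA p (p * cexp (π * I * τ + 2 * π * I * x)) *
    skA p (cexp (π * I * τ - 2 * π * I * x))) * e4

lemma skP_zero (t : ℝ) (ht : 0 < t) (x : ℂ) (hx : skP (t * I) x = 0) :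
    ∃ m k : ℤ, x = (1/2 + t * I / 2) + m + k * (t * I) := by
  have hp := sk_norm_p t ht
  unfold skP at hx
  set τ : ℂ := t * I
  have hpi : (π : ℂ) ≠ 0 := by exact_mod_cast Real.pi_ne_zero
  have hI := I_ne_zero
  rcases mul_eq_zero.1 hx with h | h
  · by_contra hcon
    refine skA_ne _ hp _ (fun n hn => hcon ?_) h
    rw [← Complex.exp_nat_mul, ← Complex.exp_add] at hn
    have : cexp (π * I * τ + 2 * π * I * x + n * (2 * π * I * τ)) = cexp (π * I) := by
      rw [Complex.exp_pi_mul_I]; linear_combination hn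
    obtain ⟨m, hm⟩ := Complex.exp_eq_exp_iff_exists_int.1 this
    refine ⟨m, -n - 1, ?_⟩
    have h2 : (2 * π * I) * x = (2 * π * I) * ((1/2 + τ / 2) + m + ((-n - 1 : ℤ) : ℂ) * τ) := by
      push_cast
      linear_combination hm
    exact mul_left_cancel₀ (by simp [hpi]) h2
  · by_contra hcon
    refine skA_ne _ hp _ (fun n hn => hcon ?_) h
    rw [← Complex.exp_nat_mul, ← Complex.exp_add] at hn
    have : cexp (π * I * τ - 2 * π * I * x + n * (2 * π * I * τ)) = cexp (π * I) := by
      rw [Complex.exp_pi_mul_I]; linear_combination hn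
    obtain ⟨m, hm⟩ := Complex.exp_eq_exp_iff_exists_int.1 this
    refine ⟨-m - 1, n, ?_⟩
    have h2 : (2 * π * I) * x = (2 * π * I) * ((1/2 + τ / 2) + ((-m - 1 : ℤ) : ℂ) + ((n : ℤ) : ℂ) * τ) := by
      push_cast
      linear_combination -hm
    exact mul_left_cancel₀ (by simp [hpi]) h2

lemma sk_simple_shift (P M : ℂ → ℂ) (hP : Differentiable ℂ P) (hM : Differentiable ℂ M)
    (hM0 : ∀ x, M x ≠ 0) (ω : ℂ) (h : ∀ x, P (x + ω) = M x * P x) (x : ℂ) :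
    (P (x + ω) = 0 → deriv P (x + ω) ≠ 0) ↔ (P x = 0 → deriv P x ≠ 0) := by
  have e : deriv P (x + ω) = deriv M x * P x + M x * deriv P x := by
    rw [← deriv_comp_add_const, ← deriv_fun_mul (hM x) (hP x)]
    congr 1
    funext y; exact h y
  rw [e, h]
  have := hM0 x
  constructor
  · intro h1 h2 h3
    exact h1 (by simp [h2]) (by simp [h2, h3])
  · intro h1 h2 h3
    have h4 : P x = 0 := by simpa [this] using h2
    exact h1 h4 (by simpa [h4, this] using h3)

lemma skP_simple (t : ℝ) (ht : 0 < t) (x : ℂ) (hx : skP (t * I) x = 0) :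
    deriv (skP (t * I)) x ≠ 0 := by
  have hp := sk_norm_p t ht
  obtain ⟨m, k, rfl⟩ := skP_zero t ht x hx
  have hd := skP_diff t ht
  revert hx
  rw [sk_lat (t * I) (fun x => skP (t * I) x = 0 → deriv (skP (t * I)) x ≠ 0)
    (fun x => sk_simple_shift _ (fun _ => 1) hd (by fun_prop) (by simp) 1
      (fun x => by simp [skP_add_one]) x)
    (fun x => sk_simple_shift _ (fun x => cexp (-π * I * (t * I + 2 * x))) hd (by fun_prop)
      (fun x => Complex.exp_ne_zero _) (t * I) (fun x => skP_add_tau t ht x) x)]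
  intro _
  set τ : ℂ := t * I with hτ
  set p := cexp (2 * π * I * τ) with hpdef
  have hAp : skA p (-p) ≠ 0 := by
    refine skA_ne p hp _ fun n hn => ?_
    have h1 : p ^ (n + 1) = 1 := by linear_combination -hn
    have h2 : ‖p‖ ^ (n + 1) = 1 := by rw [← norm_pow, h1, norm_one]
    exact (pow_lt_one₀ (norm_nonneg _) hp (Nat.succ_ne_zero n)).ne h2
  set c : ℂ := 1/2 + τ/2 with hc
  set B : ℂ → ℂ := fun x => skA p (cexp (π * I * τ + 2 * π * I * x)) *
    skA p (p * cexp (π * I * τ - 2 * π * I * x)) with hB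
  have hBd : Differentiable ℂ B := by
    have h := skA_diff p hp
    intro x
    refine DifferentiableAt.mul ?_ ?_
    · exact (h _).comp x (by fun_prop)
    · exact (h _).comp x (by fun_prop)
  have hP : skP τ = fun x => (1 + cexp (π * I * τ - 2 * π * I * x)) * B x := by
    funext x
    simp only [skP, hB]
    rw [← hpdef, skA_step p hp (cexp (π * I * τ - 2 * π * I * x))]
    ring
  have e1 : cexp (π * I * τ - 2 * π * I * c) = -1 := by
    rw [← Complex.exp_pi_mul_I, ← Complex.exp_periodic.sub_eq (π * I)]; congr 1; rw [hc]; ring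
  have e2 : cexp (π * I * τ + 2 * π * I * c) = -p := by
    rw [show (π * I * τ + 2 * π * I * c : ℂ) = 2 * π * I * τ + π * I by rw [hc]; ring,
      Complex.exp_add, Complex.exp_pi_mul_I, hpdef]; ring
  have hBc : B c ≠ 0 := by
    simp only [hB, e1, e2]
    simpa using hAp
  have hder : HasDerivAt (fun x => 1 + cexp (π * I * τ - 2 * π * I * x))
      (cexp (π * I * τ - 2 * π * I * c) * (-(2 * π * I))) c := by
    have : HasDerivAt (fun x => π * I * τ - 2 * π * I * x) (-(2 * π * I)) c := by
      simpa using ((hasDerivAt_id c).const_mul (2 * π * I)).const_sub (π * I * τ)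
    simpa using (this.cexp).const_add 1
  rw [hP, (hder.fun_mul (hBd c).hasDerivAt).deriv, e1]
  simp [hBc]

lemma sk_dense (t : ℝ) (a b : ℂ) (ha : a ≠ 0) (x0 : ℂ) (S : Set ℂ)
    (hS : ∀ z, z ∉ S → ∃ m k : ℤ, a * z + b = x0 + m + k * (t * I)) : Dense S := by
  have hc : (Set.range fun mk : ℤ × ℤ => (x0 + mk.1 + mk.2 * (t * I) - b) / a).Countable :=
    Set.countable_range _
  refine (hc.dense_compl ℂ).mono ?_
  intro z hz
  by_contra h
  obtain ⟨m, k, hmk⟩ := hS z h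
  exact hz ⟨(m, k), by simp only; rw [← hmk]; field_simp; ring⟩

lemma sk_j_c (τ : ℂ) : jacobiTheta₂ (1/2 + τ/2) τ = 0 := by
  have h1 := jacobiTheta₂_neg_left (1/2 + τ/2) τ
  have h2 := jacobiTheta₂_add_left' (-(1/2 + τ/2) + 1) τ
  rw [jacobiTheta₂_add_left, h1] at h2
  rw [show (-(1/2 + τ/2) + 1 + τ : ℂ) = 1/2 + τ/2 by ring,
    show (-π * I * (τ + 2 * (-(1/2 + τ/2) + 1)) : ℂ) = -(π * I) by ring, Complex.exp_neg,
    Complex.exp_pi_mul_I] at h2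
  norm_num at h2
  linear_combination h2 / 2

lemma sk_j_zero_zero (t : ℝ) (ht : 0 < t) : jacobiTheta₂ 0 (t * I) ≠ 0 := by
  have him : 0 < (t * I : ℂ).im := by simpa using ht
  have h := hasSum_jacobiTheta₂_term 0 him
  have hr := Complex.hasSum_re h
  have hpos : ∀ n : ℤ, 0 < (jacobiTheta₂_term n 0 (t * I)).re := by
    intro n
    have : jacobiTheta₂_term n 0 (t * I) = ((Real.exp (-(π * n ^ 2 * t)) : ℝ) : ℂ) := by
      rw [jacobiTheta₂_term]
      push_cast
      congr 1
      linear_combination (π * n ^ 2 * t : ℂ) * I_mul_I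
    rw [this, ofReal_re]
    exact Real.exp_pos _
  intro h0
  have := hr.summable.tsum_pos (fun n => (hpos n).le) 0 (hpos 0)
  rw [hr.tsum_eq, h0] at this
  simp at this

lemma sk_triple (t : ℝ) (ht : 0 < t) :
    ∃ C : ℂ, C ≠ 0 ∧ ∀ x, jacobiTheta₂ x (t * I) = C * skP (t * I) x := by
  have him : 0 < (t * I : ℂ).im := by simpa using ht
  have hj : Differentiable ℂ (fun x => jacobiTheta₂ x (t * I)) :=
    fun x => differentiableAt_jacobiTheta₂_fst x him
  obtain ⟨C, hC⟩ := sk_const t ht (skP (t * I)) (fun x => jacobiTheta₂ x (t * I)) (skP_diff t ht) hj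
    (skP_simple t ht) (fun z hz => by
      obtain ⟨m, k, rfl⟩ := skP_zero t ht z hz
      refine (sk_lat (t * I) (fun x => jacobiTheta₂ x (t * I) = 0) ?_ ?_ m k _).2 (sk_j_c _)
      · intro x; simp only [jacobiTheta₂_add_left]
      · intro x; simp only [jacobiTheta₂_add_left']; simp)
    (sk_dense t 1 0 one_ne_zero (1/2 + t * I / 2) _ (fun z hz => by
      simpa using skP_zero t ht z (by simpa using hz)))
    (fun _ => 1) (fun x => cexp (-π * I * (t * I + 2 * x))) (by simp) (fun x => Complex.exp_ne_zero _)
    (fun z => by simp [skP_add_one]) (fun z => by simp [jacobiTheta₂_add_left])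
    (fun z => skP_add_tau t ht z) (fun z => jacobiTheta₂_add_left' z _)
  refine ⟨C, ?_, hC⟩
  rintro rfl
  exact sk_j_zero_zero t ht (by simpa using hC 0)

lemma sk_exp_neg (a b : ℂ) (k : ℤ) (h : a = b + π * I + k * (2 * π * I)) : cexp a = - cexp b := by
  rw [h, Complex.exp_periodic.int_mul k, Complex.exp_add, Complex.exp_pi_mul_I]; ring

/-- quasi-period multiplier -/
def skE (τ x : ℂ) : ℂ := cexp (-(2 * π * I * x) - π * I * τ)

lemma skE_ne (τ x : ℂ) : skE τ x ≠ 0 := Complex.exp_ne_zero _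

/-- theta functions of order one with parity `ε` and multiplier signs `ρ₁, ρ₂` -/
structure SkQ (τ : ℂ) (φ : ℂ → ℂ) (ε ρ₁ ρ₂ : ℂ) : Prop where
  diff : Differentiable ℂ φ
  neg : ∀ x, φ (-x) = ε * φ x
  add_one : ∀ x, φ (x + 1) = ρ₁ * φ x
  add_tau : ∀ x, φ (x + τ) = ρ₂ * skE τ x * φ x

/-- the normalised even theta function -/
def skW (τ x : ℂ) : ℂ := cexp (π * I * x) * θf τ (x + 1/2 + τ/2)

lemma sk_theta_eq (τ x : ℂ) :
    θf τ x = I * cexp (π * I * τ / 4 - π * I * x) * jacobiTheta₂ (x + 1/2 - τ/2) τ := by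
  unfold θf jacobiTheta₂ cπ
  rw [mul_assoc I (cexp _)]
  congr 1
  rw [← tsum_mul_left]
  apply tsum_congr
  intro n
  rw [jacobiTheta₂_term, ← Complex.exp_pi_mul_I, ← Complex.exp_int_mul, ← Complex.exp_add,
    ← Complex.exp_add]
  congr 1
  ring

lemma sk_theta_Q (τ : ℂ) (hτ : 0 < τ.im) : SkQ τ (θf τ) (-1) (-1) (-1) where
  diff := by
    have : θf τ = fun x => I * cexp (π * I * τ / 4 - π * I * x) * jacobiTheta₂ (x + 1/2 - τ/2) τ :=
      funext (sk_theta_eq τ)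
    rw [this]
    intro x
    refine DifferentiableAt.mul (by fun_prop) ?_
    exact (differentiableAt_jacobiTheta₂_fst _ hτ).comp x (by fun_prop)
  neg x := by
    rw [sk_theta_eq, sk_theta_eq]
    have h : jacobiTheta₂ (-x + 1/2 - τ/2) τ =
        cexp (-(2 * π * I * x) - π * I) * jacobiTheta₂ (x + 1/2 - τ/2) τ := by
      rw [← jacobiTheta₂_neg_left, ← jacobiTheta₂_add_left,
        show (-(-x + 1/2 - τ/2) + 1 : ℂ) = (x + 1/2 - τ/2) + τ by ring, jacobiTheta₂_add_left']
      congr 2; ring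
    rw [h, Complex.exp_sub (-(2 * π * I * x)), Complex.exp_pi_mul_I]
    have e : cexp (π * I * τ / 4 - π * I * (-x)) * cexp (-(2 * π * I * x)) =
        cexp (π * I * τ / 4 - π * I * x) := by
      rw [← Complex.exp_add]; congr 1; ring
    rw [← e]; ring
  add_one x := by
    rw [sk_theta_eq, sk_theta_eq, show (x + 1 + 1/2 - τ/2 : ℂ) = x + 1/2 - τ/2 + 1 by ring,
      jacobiTheta₂_add_left, show (π * I * τ / 4 - π * I * (x + 1) : ℂ) =
        π * I * τ / 4 - π * I * x - π * I by ring, Complex.exp_sub _ (π * I), Complex.exp_pi_mul_I]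
    ring
  add_tau x := by
    rw [sk_theta_eq, sk_theta_eq, show (x + τ + 1/2 - τ/2 : ℂ) = x + 1/2 - τ/2 + τ by ring,
      jacobiTheta₂_add_left']
    have e : cexp (π * I * τ / 4 - π * I * (x + τ)) * cexp (-π * I * (τ + 2 * (x + 1/2 - τ/2)))
      = - (skE τ x * cexp (π * I * τ / 4 - π * I * x)) := by
      rw [skE, ← Complex.exp_add, ← Complex.exp_add]
      apply sk_exp_neg _ _ (-1)
      push_cast; ring
    linear_combination I * jacobiTheta₂ (x + 1/2 - τ/2) τ * e

lemma sk_theta_sub_tau (τ : ℂ) (hτ : 0 < τ.im) (x : ℂ) :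
    θf τ (x - τ) = -cexp (2 * π * I * x - π * I * τ) * θf τ x := by
  have h := (sk_theta_Q τ hτ).add_tau (x - τ)
  rw [sub_add_cancel] at h
  have e : cexp (2 * π * I * x - π * I * τ) * skE τ (x - τ) = 1 := by
    rw [skE, ← Complex.exp_add, ← Complex.exp_zero]; congr 1; ring
  rw [h]
  linear_combination -θf τ (x - τ) * e

lemma sk_theta_sub_one (τ : ℂ) (hτ : 0 < τ.im) (x : ℂ) : θf τ (x - 1) = -θf τ x := by
  have h := (sk_theta_Q τ hτ).add_one (x - 1)
  rw [sub_add_cancel] at h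
  rw [h]; ring

/-- The four theta functions. -/
def skφ (τ : ℂ) (i : Fin 4) (x : ℂ) : ℂ :=
  if i = 0 then θf τ x else if i = 1 then θf τ (x + 1/2) else if i = 2 then skW τ x
  else cexp (π * I * x) * θf τ (x + τ/2)

lemma sk_W_Q (τ : ℂ) (hτ : 0 < τ.im) : SkQ τ (skW τ) 1 1 1 where
  diff := by
    have := (sk_theta_Q τ hτ).diff
    unfold skW; fun_prop
  neg x := by
    unfold skW
    rw [show (-x + 1/2 + τ/2 : ℂ) = -((x + 1/2 + τ/2) - 1 - τ) by ring, (sk_theta_Q τ hτ).neg,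
      sk_theta_sub_tau τ hτ, sk_theta_sub_one τ hτ]
    have e : cexp (π * I * -x) * cexp (2 * π * I * (x + 1/2 + τ/2 - 1) - π * I * τ) =
       - cexp (π * I * x) := by
      rw [← Complex.exp_add]
      apply sk_exp_neg _ _ (-1)
      push_cast; ring
    linear_combination - θf τ (x + 1/2 + τ/2) * e
  add_one x := by
    unfold skW
    rw [show (x + 1 + 1/2 + τ/2 : ℂ) = x + 1/2 + τ/2 + 1 by ring, (sk_theta_Q τ hτ).add_one,
      mul_add, Complex.exp_add, mul_one, Complex.exp_pi_mul_I]
    ring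
  add_tau x := by
    unfold skW
    rw [show (x + τ + 1/2 + τ/2 : ℂ) = x + 1/2 + τ/2 + τ by ring, (sk_theta_Q τ hτ).add_tau]
    have e : cexp (π * I * (x + τ)) * skE τ (x + 1/2 + τ/2) =
       - (skE τ x * cexp (π * I * x)) := by
      rw [← neg_one_mul, ← Complex.exp_pi_mul_I, skE, skE, ← Complex.exp_add, ← Complex.exp_add,
        ← Complex.exp_add, ← Complex.exp_periodic]
      congr 1; ring
    linear_combination - θf τ (x + 1/2 + τ/2) * e

/-- parity -/
def skε (i : Fin 4) : ℂ := if i = 0 then -1 else 1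
def skσ (i : Fin 4) : ℂ := if i = 2 then -1 else 1
def skρ₁ (i : Fin 4) : ℂ := if i = 0 then -1 else if i = 1 then -1 else 1
def skρ₂ (i : Fin 4) : ℂ := if i = 0 then -1 else if i = 3 then -1 else 1

lemma sk_signs (i : Fin 4) : skε i ^ 2 = 1 ∧ skσ i ^ 2 = 1 ∧ skρ₁ i ^ 2 = 1 ∧ skρ₂ i ^ 2 = 1 ∧
    skρ₁ i * skρ₂ i = - (skσ i * skε i) := by
  fin_cases i <;> simp [skε, skσ, skρ₁, skρ₂]

lemma sk_φ_Q (τ : ℂ) (hτ : 0 < τ.im) (i : Fin 4) : SkQ τ (skφ τ i) (skε i) (skρ₁ i) (skρ₂ i) := by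
  have hθ := sk_theta_Q τ hτ
  fin_cases i
  · simpa [skε, skρ₁, skρ₂, show skφ τ 0 = θf τ from rfl] using hθ
  · have : skφ τ 1 = fun x => θf τ (x + 1/2) := rfl
    simp only [skε, skρ₁, skρ₂]
    simp
    rw [this]
    refine ⟨by have := hθ.diff; fun_prop, ?_, ?_, ?_⟩
    · intro x
      rw [show (-x + 1/2 : ℂ) = -((x + 1/2) - 1) by ring, hθ.neg, sk_theta_sub_one τ hτ]; ring
    · intro x
      rw [show (x + 1 + 1/2 : ℂ) = ((x + 1/2) + 1) by ring, hθ.add_one]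
    · intro x
      rw [show (x + τ + 1/2 : ℂ) = ((x + 1/2) + τ) by ring, hθ.add_tau]
      have e : skE τ (x + 1/2) = - skE τ x := by
        rw [← neg_one_mul, ← Complex.exp_pi_mul_I, skE, skE, ← Complex.exp_add,
         ← Complex.exp_periodic]
        congr 1; ring
      rw [e]; ring
  · have : skφ τ 2 = skW τ := rfl
    simp only [skε, skρ₁, skρ₂]
    simp
    rw [this]
    exact sk_W_Q τ hτ
  · have : skφ τ 3 = fun x => cexp (π * I * x) * θf τ (x + τ/2) := rfl
    simp only [skε, skρ₁, skρ₂]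
    simp
    rw [this]
    refine ⟨by have := hθ.diff; fun_prop, ?_, ?_, ?_⟩
    · intro x
      rw [show (-x + τ/2 : ℂ) = -((x + τ/2) - τ) by ring, hθ.neg, sk_theta_sub_tau τ hτ]
      have e : cexp (π * I * -x) * cexp (2 * π * I * (x + τ/2) - π * I * τ) = cexp (π * I * x) := by
        rw [← Complex.exp_add]; congr 1; ring
      linear_combination θf τ (x + τ/2) * e
    · intro x
      rw [show (x + 1 + τ/2 : ℂ) = ((x + τ/2) + 1) by ring, hθ.add_one, mul_add, Complex.exp_add, mul_one, Complex.exp_pi_mul_I]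
      ring
    · intro x
      rw [show (x + τ + τ/2 : ℂ) = ((x + τ/2) + τ) by ring, hθ.add_tau]
      have e : cexp (π * I * (x + τ)) * skE τ (x + τ/2) = skE τ x * cexp (π * I * x) := by
        rw [skE, skE, ← Complex.exp_add, ← Complex.exp_add]
        congr 1; ring
      linear_combination - θf τ (x + τ/2) * e

lemma sk_W_c (τ : ℂ) (hτ : 0 < τ.im) (x : ℂ) :
    skW τ (x + (1/2 + τ/2)) = cexp (π * I * (1/2 + τ/2) - π * I * τ) * cexp (-(π * I * x)) * θf τ x := by
  have hθ := sk_theta_Q τ hτ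
  unfold skW
  rw [show (x + (1/2 + τ/2) + 1/2 + τ/2 : ℂ) = x + τ + 1 by ring, hθ.add_one, hθ.add_tau]
  have e : cexp (π * I * (x + (1/2 + τ/2))) * skE τ x =
      cexp (π * I * (1/2 + τ/2) - π * I * τ) * cexp (-(π * I * x)) := by
    rw [skE, ← Complex.exp_add, ← Complex.exp_add]; congr 1; ring
  linear_combination θf τ x * e

lemma sk_W_j (τ x : ℂ) : skW τ x = (I * cexp (-(π * I * τ / 4) - π * I / 2)) * jacobiTheta₂ x τ := by
  unfold skW
  rw [sk_theta_eq, show (x + 1/2 + τ/2 + 1/2 - τ/2 : ℂ) = x + 1 by ring, jacobiTheta₂_add_left]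
  have e : cexp (π * I * x) * cexp (π * I * τ / 4 - π * I * (x + 1/2 + τ/2)) =
     cexp (-(π * I * τ / 4) - π * I / 2) := by
    rw [← Complex.exp_add]; congr 1; ring
  linear_combination I * jacobiTheta₂ x τ * e

lemma sk_W_P (t : ℝ) (ht : 0 < t) : ∃ C : ℂ, C ≠ 0 ∧ ∀ x, skW (t * I) x = C * skP (t * I) x := by
  obtain ⟨C, hC, h⟩ := sk_triple t ht
  refine ⟨(I * cexp (-(π * I * (t * I) / 4) - π * I / 2)) * C, ?_, fun x => ?_⟩
  · simp [hC]
  · rw [sk_W_j, h]; ring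

lemma sk_W_zero (t : ℝ) (ht : 0 < t) (x : ℂ) (hx : skW (t * I) x = 0) :
    ∃ m k : ℤ, x = (1/2 + t * I / 2) + m + k * (t * I) := by
  obtain ⟨C, hC, h⟩ := sk_W_P t ht
  rw [h] at hx
  exact skP_zero t ht x (by simpa [hC] using hx)

lemma sk_W_simple (t : ℝ) (ht : 0 < t) (x : ℂ) (hx : skW (t * I) x = 0) :
    deriv (skW (t * I)) x ≠ 0 := by
  obtain ⟨C, hC, h⟩ := sk_W_P t ht
  rw [h] at hx
  have := skP_simple t ht x (by simpa [hC] using hx)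
  rw [funext h, deriv_const_mul _ (skP_diff t ht x)]
  exact mul_ne_zero hC this

lemma sk_theta_W (τ : ℂ) (hτ : 0 < τ.im) (x : ℂ) :
    θf τ x = cexp (-(π * I * (1/2 + τ/2) - π * I * τ)) * cexp (π * I * x) * skW τ (1 * x + (1/2 + τ/2)) := by
  rw [one_mul, sk_W_c τ hτ, Complex.exp_neg, Complex.exp_neg]
  field_simp [Complex.exp_ne_zero]

lemma sk_theta_zero (t : ℝ) (ht : 0 < t) (x : ℂ) (hx : θf (t * I) x = 0) :
    ∃ m k : ℤ, x = m + k * (t * I) := by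
  have hτ : 0 < (t * I : ℂ).im := by simpa using ht
  rw [sk_theta_W _ hτ] at hx
  have : skW (t * I) (1 * x + (1/2 + t * I/2)) = 0 := by simpa using hx
  obtain ⟨m, k, h⟩ := sk_W_zero t ht _ this
  exact ⟨m, k, by linear_combination h⟩

lemma sk_theta_simple (t : ℝ) (ht : 0 < t) (x : ℂ) (hx : θf (t * I) x = 0) :
    deriv (θf (t * I)) x ≠ 0 := by
  have hτ : 0 < (t * I : ℂ).im := by simpa using ht
  have hW := (sk_W_Q _ hτ).diff
  rw [funext (sk_theta_W _ hτ)]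
  rw [sk_theta_W _ hτ] at hx
  refine sk_simple_mul (fun x => cexp (-(π * I * (1/2 + (t * I)/2) - π * I * (t * I))) * cexp (π * I * x))
    (fun x => skW (t * I) (1 * x + (1/2 + (t * I)/2))) (by fun_prop) (by fun_prop) ?_ ?_ ?_ x hx
  · intro z hz; simp at hz
  · exact sk_simple_comp _ hW (sk_W_simple t ht) 1 _ one_ne_zero
  · intro z hz; simp at hz

/-- membership in the period lattice -/
def skL (t : ℝ) (x : ℂ) : Prop := ∃ m k : ℤ, x = m + k * (t * I)

lemma skL_add {t : ℝ} {x y : ℂ} (hx : skL t x) (hy : skL t y) : skL t (x + y) := by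
  obtain ⟨m, k, rfl⟩ := hx
  obtain ⟨m', k', rfl⟩ := hy
  exact ⟨m + m', k + k', by push_cast; ring⟩

lemma skL_sub {t : ℝ} {x y : ℂ} (hx : skL t x) (hy : skL t y) : skL t (x - y) := by
  obtain ⟨m, k, rfl⟩ := hx
  obtain ⟨m', k', rfl⟩ := hy
  exact ⟨m - m', k - k', by push_cast; ring⟩

lemma skL_one_tau (t : ℝ) : skL t (1 + t * I) := ⟨1, 1, by simp⟩

lemma skL_countable (t : ℝ) (b : ℂ) : {z : ℂ | skL t (2 * z + b)}.Countable := by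
  have hc : (Set.range fun mk : ℤ × ℤ => ((mk.1 : ℂ) + mk.2 * (t * I) - b) / 2).Countable :=
    Set.countable_range _
  refine hc.mono ?_
  rintro z ⟨m, k, h⟩
  refine ⟨(m, k), ?_⟩
  simp only
  rw [← h]; ring

lemma sk_W_zero2 (t : ℝ) (ht : 0 < t) (x : ℂ) (hx : skW (t * I) x = 0) : skL t (2 * x) := by
  obtain ⟨m, k, rfl⟩ := sk_W_zero t ht x hx
  exact ⟨1 + 2 * m, 1 + 2 * k, by push_cast; ring⟩

/-- the four-term expression -/
def skT (τ : ℂ) (φ : ℂ → ℂ) (ε σ u v n : ℂ) : ℂ :=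
  φ (2*u - n) * θf τ (2*v) * skW τ (u+v+n) * skW τ (u-v+n)
  - ε * φ (2*u+n) * θf τ (2*v) * skW τ (u+v-n) * skW τ (u-v-n)
  + σ * θf τ (2*u) * (ε * φ (2*v+n) * skW τ (u+v-n) * skW τ (u-v+n)
    - φ (2*v-n) * skW τ (u+v+n) * skW τ (u-v-n))

section
variable {τ : ℂ} {φ : ℂ → ℂ} {ε ρ₁ ρ₂ : ℂ}

lemma SkQ.add_two_tau (h : SkQ τ φ ε ρ₁ ρ₂) (h2 : ρ₂ ^ 2 = 1) (x : ℂ) :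
    φ (x + 2 * τ) = cexp (-(4 * π * I * x) - 4 * π * I * τ) * φ x := by
  rw [show x + 2 * τ = x + τ + τ by ring, h.add_tau, h.add_tau]
  have e : skE τ (x + τ) * skE τ x = cexp (-(4 * π * I * x) - 4 * π * I * τ) := by
    rw [skE, skE, ← Complex.exp_add]; congr 1; ring
  rw [← e]
  linear_combination skE τ (x + τ) * skE τ x * φ x * h2

lemma SkQ.add_two (h : SkQ τ φ ε ρ₁ ρ₂) (h1 : ρ₁ ^ 2 = 1) (x : ℂ) : φ (x + 2) = φ x := by
  rw [show x + 2 = x + 1 + 1 by ring, h.add_one, h.add_one]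
  linear_combination φ x * h1

lemma SkQ.sub_one (h : SkQ τ φ ε ρ₁ ρ₂) (h1 : ρ₁ ^ 2 = 1) (x : ℂ) : φ (x - 1) = ρ₁ * φ x := by
  have := h.add_one (x - 1)
  rw [sub_add_cancel] at this
  rw [this]
  linear_combination - φ (x - 1) * h1

lemma SkQ.sub_tau (h : SkQ τ φ ε ρ₁ ρ₂) (h2 : ρ₂ ^ 2 = 1) (x : ℂ) :
    φ (x - τ) = ρ₂ * cexp (2 * π * I * x - π * I * τ) * φ x := by
  have := h.add_tau (x - τ)
  rw [sub_add_cancel] at this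
  rw [this]
  have e : cexp (2 * π * I * x - π * I * τ) * skE τ (x - τ) = 1 := by
    rw [skE, ← Complex.exp_add, ← Complex.exp_zero]; congr 1; ring
  linear_combination - φ (x - τ) * (h2 * cexp (2 * π * I * x - π * I * τ) * skE τ (x - τ) + e)

lemma SkQ.neg' (h : SkQ τ φ ε ρ₁ ρ₂) {x y : ℂ} (e : x = -y) : φ x = ε * φ y := by
  rw [e, h.neg]


lemma skT_neg_u (hτ : 0 < τ.im) (h : SkQ τ φ ε ρ₁ ρ₂) (hε : ε ^ 2 = 1) (σ u v n : ℂ) :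
    skT τ φ ε σ (-u) v n = - skT τ φ ε σ u v n := by
  unfold skT
  have hθ := sk_theta_Q τ hτ
  have hW := sk_W_Q τ hτ
  rw [h.neg' (show 2 * -u - n = -(2*u+n) by ring), h.neg' (show 2 * -u + n = -(2*u-n) by ring),
    hθ.neg' (show 2 * -u = -(2*u) by ring), hW.neg' (show -u+v+n = -(u-v-n) by ring),
    hW.neg' (show -u-v+n = -(u+v-n) by ring), hW.neg' (show -u+v-n = -(u-v+n) by ring),
    hW.neg' (show -u-v-n = -(u+v+n) by ring)]
  linear_combination - φ (2*u - n) * θf τ (2*v) * skW τ (u+v+n) * skW τ (u-v+n) * hε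

lemma skT_neg_v (hτ : 0 < τ.im) (h : SkQ τ φ ε ρ₁ ρ₂) (hε : ε ^ 2 = 1) (σ u v n : ℂ) :
    skT τ φ ε σ u (-v) n = - skT τ φ ε σ u v n := by
  unfold skT
  have hθ := sk_theta_Q τ hτ
  rw [h.neg' (show 2 * -v - n = -(2*v+n) by ring), h.neg' (show 2 * -v + n = -(2*v-n) by ring),
    hθ.neg' (show 2 * -v = -(2*v) by ring), show u + -v = u - v by ring, show u - -v = u + v by ring]
  linear_combination σ * θf τ (2*u) * φ (2*v - n) * skW τ (u+v+n) * skW τ (u-v-n) * hε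

lemma skT_add_one (hτ : 0 < τ.im) (h : SkQ τ φ ε ρ₁ ρ₂) (h1 : ρ₁ ^ 2 = 1) (σ u v n : ℂ) :
    skT τ φ ε σ (u + 1) v n = skT τ φ ε σ u v n := by
  unfold skT
  have hθ := sk_theta_Q τ hτ
  have hW := sk_W_Q τ hτ
  rw [show 2 * (u + 1) - n = 2 * u - n + 2 by ring, show 2 * (u + 1) + n = 2 * u + n + 2 by ring,
    show 2 * (u + 1) = 2 * u + 2 by ring, show u + 1 + v + n = u + v + n + 1 by ring,
    show u + 1 - v + n = u - v + n + 1 by ring, show u + 1 - v - n = u - v - n + 1 by ring,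
    show u + 1 + v - n = u + v - n + 1 by ring,
    h.add_two h1, h.add_two h1, hθ.add_two (by norm_num), hW.add_one, hW.add_one, hW.add_one,
    hW.add_one]
  ring

lemma skT_add_tau (hτ : 0 < τ.im) (h : SkQ τ φ ε ρ₁ ρ₂) (h2 : ρ₂ ^ 2 = 1) (σ u v n : ℂ) :
    skT τ φ ε σ (u + τ) v n = cexp (-(12 * π * I * u) - 6 * π * I * τ) * skT τ φ ε σ u v n := by
  unfold skT
  have hθ := sk_theta_Q τ hτ
  have hW := sk_W_Q τ hτ
  rw [show 2 * (u + τ) - n = 2 * u - n + 2 * τ by ring,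
    show 2 * (u + τ) + n = 2 * u + n + 2 * τ by ring,
    show 2 * (u + τ) = 2 * u + 2 * τ by ring, show u + τ + v + n = u + v + n + τ by ring,
    show u + τ - v + n = u - v + n + τ by ring, show u + τ - v - n = u - v - n + τ by ring,
    show u + τ + v - n = u + v - n + τ by ring,
    h.add_two_tau h2, h.add_two_tau h2, hθ.add_two_tau (by norm_num), hW.add_tau, hW.add_tau,
    hW.add_tau, hW.add_tau]
  have e1 : cexp (-(4 * π * I * (2 * u - n)) - 4 * π * I * τ) * skE τ (u + v + n) *
    skE τ (u - v + n) = cexp (-(12 * π * I * u) - 6 * π * I * τ) := by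
    rw [skE, skE, ← Complex.exp_add, ← Complex.exp_add]; congr 1; ring
  have e2 : cexp (-(4 * π * I * (2 * u + n)) - 4 * π * I * τ) * skE τ (u + v - n) *
    skE τ (u - v - n) = cexp (-(12 * π * I * u) - 6 * π * I * τ) := by
    rw [skE, skE, ← Complex.exp_add, ← Complex.exp_add]; congr 1; ring
  have e3 : cexp (-(4 * π * I * (2 * u)) - 4 * π * I * τ) * skE τ (u + v - n) *
    skE τ (u - v + n) = cexp (-(12 * π * I * u) - 6 * π * I * τ) := by
    rw [skE, skE, ← Complex.exp_add, ← Complex.exp_add]; congr 1; ring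
  have e4 : cexp (-(4 * π * I * (2 * u)) - 4 * π * I * τ) * skE τ (u + v + n) *
    skE τ (u - v - n) = cexp (-(12 * π * I * u) - 6 * π * I * τ) := by
    rw [skE, skE, ← Complex.exp_add, ← Complex.exp_add]; congr 1; ring
  linear_combination φ (2*u - n) * θf τ (2*v) * skW τ (u+v+n) * skW τ (u-v+n) * e1
   - ε * φ (2*u+n) * θf τ (2*v) * skW τ (u+v-n) * skW τ (u-v-n) * e2
   + σ * θf τ (2*u) * (ε * φ (2*v+n) * skW τ (u+v-n) * skW τ (u-v+n) * e3
    - φ (2*v-n) * skW τ (u+v+n) * skW τ (u-v-n) * e4)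

lemma skT_lat (hτ : 0 < τ.im) (h : SkQ τ φ ε ρ₁ ρ₂) (h1 : ρ₁ ^ 2 = 1) (h2 : ρ₂ ^ 2 = 1)
    (σ u v n : ℂ) (m k : ℤ) :
    skT τ φ ε σ (u + m + k * τ) v n = 0 ↔ skT τ φ ε σ u v n = 0 := by
  refine sk_lat τ (fun u => skT τ φ ε σ u v n = 0) (fun x => ?_) (fun x => ?_) m k u
  · rw [skT_add_one hτ h h1]
  · rw [skT_add_tau hτ h h2]; simp

lemma skT_half (hτ : 0 < τ.im) (h : SkQ τ φ ε ρ₁ ρ₂) (hε : ε ^ 2 = 1) (h1 : ρ₁ ^ 2 = 1)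
    (h2 : ρ₂ ^ 2 = 1) (σ u v n : ℂ) (m k : ℤ) (hu : 2 * u = m + k * τ) :
    skT τ φ ε σ u v n = 0 := by
  have key : ∀ a b : ℂ, a = -b → a = b → a = 0 := fun a b h h' => by
    have : 2 * a = 0 := by linear_combination h + h'
    simpa using this
  have ho := skT_neg_u hτ h hε σ
  have hh1 := skT_add_one hτ h h1 σ
  have hh2 := skT_add_tau hτ h h2 σ
  obtain ⟨m', hm⟩ := Int.even_or_odd' m
  obtain ⟨k', hk⟩ := Int.even_or_odd' k
  rcases hm with rfl | rfl <;> rcases hk with rfl | rfl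
  · rw [show u = 0 + m' + k' * τ by push_cast at hu; linear_combination hu / 2,
      skT_lat hτ h h1 h2]
    have := ho 0 v n
    rw [neg_zero] at this
    exact key _ _ this rfl
  · rw [show u = τ/2 + m' + k' * τ by push_cast at hu; linear_combination hu / 2,
      skT_lat hτ h h1 h2]
    have := hh2 (-(τ/2)) v n
    rw [ho, show -(τ/2) + τ = τ/2 by ring,
      show (-(12 * π * I * -(τ/2)) - 6 * π * I * τ) = 0 by ring, Complex.exp_zero] at this
    exact key _ _ (by linear_combination this) rfl
  · rw [show u = 1/2 + m' + k' * τ by push_cast at hu; linear_combination hu / 2,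
      skT_lat hτ h h1 h2]
    have := hh1 (-(1/2)) v n
    rw [ho, show -(1/2) + 1 = (1/2 : ℂ) by ring] at this
    exact key _ _ this rfl
  · rw [show u = (1/2 + τ/2) + m' + k' * τ by push_cast at hu; linear_combination hu / 2,
      skT_lat hτ h h1 h2]
    have := hh2 (-(1/2 + τ/2) + 1) v n
    rw [hh1, ho, show -(1/2 + τ/2) + 1 + τ = 1/2 + τ/2 by ring,
      show (-(12 * π * I * (-(1/2 + τ/2) + 1)) - 6 * π * I * τ) =
        0 + ((-3 : ℤ) : ℂ) * (2 * π * I) by push_cast; ring,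
      Complex.exp_periodic.int_mul, Complex.exp_zero] at this
    exact key _ _ (by linear_combination this) rfl

lemma sk_W_c0 (hτ : 0 < τ.im) : skW τ (1/2 + τ/2) = 0 := by
  have := sk_W_c τ hτ 0
  rw [zero_add] at this
  rw [this]
  have h0 := (sk_theta_Q τ hτ).neg 0
  rw [neg_zero] at h0
  have : θf τ 0 = 0 := by linear_combination h0 / 2
  rw [this, mul_zero]

lemma skT_c (hτ : 0 < τ.im) (h : SkQ τ φ ε ρ₁ ρ₂) (hε : ε ^ 2 = 1)
    (σ : ℂ) (hσ : ρ₁ * ρ₂ = -(σ * ε)) (v n : ℂ) :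
    skT τ φ ε σ (n - v + (1/2 + τ/2)) v n = 0 := by
  have hθ := sk_theta_Q τ hτ
  unfold skT
  rw [show n - v + (1/2 + τ/2) + v - n = 1/2 + τ/2 by ring, sk_W_c0 hτ,
    show 2 * (n - v + (1/2 + τ/2)) - n = -(2*v - n) + τ + 1 by ring, h.add_one, h.add_tau, h.neg,
    show 2 * (n - v + (1/2 + τ/2)) = (2*n - 2*v) + τ + 1 by ring, hθ.add_one, hθ.add_tau,
    show n - v + (1/2 + τ/2) - v + n = (2*n - 2*v) + (1/2 + τ/2) by ring,
    show n - v + (1/2 + τ/2) - v - n = (-(2*v)) + (1/2 + τ/2) by ring, sk_W_c τ hτ, sk_W_c τ hτ,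
    hθ.neg]
  set κ := cexp (π * I * (1/2 + τ/2) - π * I * τ)
  have e : skE τ (-(2*v-n)) * cexp (-(π * I * (2*n-2*v))) =
      skE τ (2*n - 2*v) * cexp (-(π * I * (-(2*v)))) := by
    rw [skE, skE, ← Complex.exp_add, ← Complex.exp_add]; congr 1; ring
  set W := skW τ (n - v + (1/2 + τ/2) + v + n)
  set B := skE τ (2*n - 2*v) * cexp (-(π * I * (-(2*v))))
  linear_combination W * φ (2*v-n) * θf τ (2*v) * θf τ (2*n-2*v) * κ *
    (ρ₁ * ρ₂ * ε * e + ε * B * hσ - σ * B * hε)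

end

lemma skT_generic (t : ℝ) (ht : 0 < t) {φ : ℂ → ℂ} {ε ρ₁ ρ₂ : ℂ}
    (h : SkQ (t * I) φ ε ρ₁ ρ₂) (hε : ε ^ 2 = 1) (h1 : ρ₁ ^ 2 = 1)
    (h2 : ρ₂ ^ 2 = 1) (σ : ℂ) (hσ : ρ₁ * ρ₂ = -(σ * ε)) (v n : ℂ)
    (g1 : ¬ skL t (2*v-2*n)) (g2 : ¬ skL t (2*v+2*n)) (g3 : ¬ skL t (2*v)) (g4 : ¬ skL t (2*n)) (u : ℂ) :
    skT (t * I) φ ε σ u v n = 0 := by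
  have hτ : 0 < (t * I : ℂ).im := by simpa using ht
  have hθ := sk_theta_Q _ hτ
  have hW := sk_W_Q _ hτ
  have hφd := h.diff
  have hθd := hθ.diff
  have hWd := hW.diff
  have hTd : Differentiable ℂ (fun u => skT (t * I) φ ε σ u v n) := by
    unfold skT; fun_prop
  set d : ℂ → ℂ := fun u => θf (t * I) (2*u+0) * (skW (t * I) (1*u+(v-n)) * skW (t * I) (1*u+(n-v))) with hd
  have hdd : Differentiable ℂ d := by rw [hd]; fun_prop
  have z1 : ∀ u, skW (t * I) (1*u+(v-n)) = 0 → skL t (2*u+(2*v-2*n)) := fun u hu => by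
    have := sk_W_zero2 t ht _ hu
    convert this using 1; ring
  have z2 : ∀ u, skW (t * I) (1*u+(n-v)) = 0 → skL t (2*u+(2*n-2*v)) := fun u hu => by
    have := sk_W_zero2 t ht _ hu
    convert this using 1; ring
  have z0 : ∀ u, θf (t * I) (2*u+0) = 0 → skL t (2*u+0) := fun u hu => sk_theta_zero t ht _ hu
  have hs : ∀ z, d z = 0 → deriv d z ≠ 0 := by
    refine sk_simple_mul _ _ (by fun_prop) (by fun_prop) ?_ ?_ ?_
    · exact sk_simple_comp _ hθd (sk_theta_simple t ht) 2 _ two_ne_zero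
    · refine sk_simple_mul _ _ (by fun_prop) (by fun_prop) ?_ ?_ ?_
      · exact sk_simple_comp _ hWd (sk_W_simple t ht) 1 _ one_ne_zero
      · exact sk_simple_comp _ hWd (sk_W_simple t ht) 1 _ one_ne_zero
      · intro z hz hz'
        obtain ⟨m, k, e⟩ := sk_W_zero t ht _ hz
        obtain ⟨m', k', e'⟩ := sk_W_zero t ht _ hz'
        exact g1 ⟨m - m', k - k', by push_cast; linear_combination e - e'⟩
    · intro z hz hz'
      have a := z0 z hz
      rcases mul_eq_zero.1 hz' with hz' | hz'
      · apply g1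
        convert skL_sub (z1 z hz') a using 1; ring
      · apply g1
        convert skL_sub a (z2 z hz') using 1; ring
  have hz : ∀ z, d z = 0 → skT (t * I) φ ε σ z v n = 0 := by
    intro z hz
    rcases mul_eq_zero.1 hz with hz | hz
    · obtain ⟨m, k, e⟩ := sk_theta_zero t ht _ hz
      exact skT_half hτ h hε h1 h2 σ z v n m k (by linear_combination e)
    · rcases mul_eq_zero.1 hz with hz | hz
      · obtain ⟨m, k, e⟩ := sk_W_zero t ht _ hz
        rw [show z = (n - v + (1/2 + t * I/2)) + m + k * (t * I) by linear_combination e,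
          skT_lat hτ h h1 h2]
        exact skT_c hτ h hε σ hσ v n
      · obtain ⟨m, k, e⟩ := sk_W_zero t ht _ hz
        rw [show z = (v - n + (1/2 + t * I/2)) + m + k * (t * I) by linear_combination e,
          skT_lat hτ h h1 h2, ← neg_eq_zero, ← skT_neg_u hτ h hε,
          show -(v - n + (1/2 + t * I/2)) = (n - v + (1/2 + t * I/2)) + ((-1:ℤ):ℂ) + ((-1:ℤ):ℂ) * (t * I) by
            push_cast; ring, skT_lat hτ h h1 h2]
        exact skT_c hτ h hε σ hσ v n
  have hdense : Dense {z | d z ≠ 0} := by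
    refine (((skL_countable t 0).union ((skL_countable t (2*v-2*n)).union
      (skL_countable t (2*n-2*v)))).dense_compl ℂ).mono ?_
    intro z hz hz'
    apply hz
    rcases mul_eq_zero.1 hz' with hz' | hz'
    · exact Or.inl (z0 z hz')
    · rcases mul_eq_zero.1 hz' with hz' | hz'
      · exact Or.inr (Or.inl (z1 z hz'))
      · exact Or.inr (Or.inr (z2 z hz'))
  obtain ⟨C, hC⟩ := sk_const t ht d (fun u => skT (t * I) φ ε σ u v n) hdd hTd hs hz hdense
    (fun _ => 1) (fun u => cexp (-(12 * π * I * u) - 6 * π * I * (t * I))) (by simp) (by simp)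
    (by
      intro z
      simp only [hd]
      rw [show 2 * (z + 1) + 0 = 2*z + 0 + 2 by ring, hθ.add_two (by norm_num),
        show 1 * (z + 1) + (v - n) = 1 * z + (v - n) + 1 by ring,
        show 1 * (z + 1) + (n - v) = 1 * z + (n - v) + 1 by ring, hW.add_one, hW.add_one]
      ring)
    (by intro z; rw [skT_add_one hτ h h1]; ring)
    (by
      intro z
      simp only [hd]
      rw [show 2 * (z + t * I) + 0 = 2*z + 0 + 2 * (t * I) by ring, hθ.add_two_tau (by norm_num),
        show 1 * (z + t * I) + (v - n) = 1 * z + (v - n) + t * I by ring,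
        show 1 * (z + t * I) + (n - v) = 1 * z + (n - v) + t * I by ring, hW.add_tau, hW.add_tau]
      have e3 : cexp (-(4 * π * I * (2 * z + 0)) - 4 * π * I * (t * I)) * skE (t * I) (1 * z + (v - n)) *
        skE (t * I) (1 * z + (n - v)) = cexp (-(12 * π * I * z) - 6 * π * I * (t * I)) := by
        rw [skE, skE, ← Complex.exp_add, ← Complex.exp_add]; congr 1; ring
      rw [← e3]; ring)
    (by intro z; rw [skT_add_tau hτ h h2])
  have h0 := hC (n - (-v) + (1/2 + t * I/2))
  have hT0 : skT (t * I) φ ε σ (n - (-v) + (1/2 + t * I/2)) v n = 0 := by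
    have a := skT_c hτ h hε σ hσ (-v) n
    rw [skT_neg_v hτ h hε] at a
    simpa using a
  simp only [hT0] at h0
  have hd0 : d (n - (-v) + (1/2 + t * I/2)) ≠ 0 := by
    intro hz
    rcases mul_eq_zero.1 hz with hz | hz
    · apply g2
      convert skL_sub (z0 _ hz) (skL_one_tau t) using 1; ring
    · rcases mul_eq_zero.1 hz with hz | hz
      · obtain ⟨m, k, e⟩ := sk_W_zero t ht _ hz
        exact g3 ⟨m, k, by linear_combination e⟩
      · obtain ⟨m, k, e⟩ := sk_W_zero t ht _ hz
        exact g4 ⟨m, k, by linear_combination e⟩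
  have : C = 0 := by
    rcases mul_eq_zero.1 h0.symm with h | h
    · exact h
    · exact absurd h hd0
  rw [hC, this, zero_mul]

lemma skT_zero (t : ℝ) (ht : 0 < t) {φ : ℂ → ℂ} {ε ρ₁ ρ₂ : ℂ}
    (h : SkQ (t * I) φ ε ρ₁ ρ₂) (hε : ε ^ 2 = 1) (h1 : ρ₁ ^ 2 = 1)
    (h2 : ρ₂ ^ 2 = 1) (σ : ℂ) (hσ : ρ₁ * ρ₂ = -(σ * ε)) (u v n : ℂ) :
    skT (t * I) φ ε σ u v n = 0 := by
  have hτ : 0 < (t * I : ℂ).im := by simpa using ht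
  have hφd := h.diff.continuous
  have hθd := (sk_theta_Q _ hτ).diff.continuous
  have hWd := (sk_W_Q _ hτ).diff.continuous
  have step : ∀ n, ¬ skL t (2*n) → ∀ v, skT (t * I) φ ε σ u v n = 0 := by
    intro n hn
    have := Continuous.ext_on (f := fun v => skT (t * I) φ ε σ u v n) (g := fun _ => (0:ℂ))
      (((skL_countable t (-2*n)).union ((skL_countable t (2*n)).union
      (skL_countable t 0))).dense_compl ℂ) (by unfold skT; fun_prop) (by fun_prop) (by
        intro v hv
        simp only [Set.compl_union, Set.mem_inter_iff, Set.mem_compl_iff, Set.mem_ofPred_eq] at hv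
        refine skT_generic t ht h hε h1 h2 σ hσ v n ?_ hv.2.1 (by simpa using hv.2.2) hn u
        have := hv.1
        rwa [show 2 * v + -2 * n = 2*v-2*n by ring] at this)
    exact fun v => congrFun this v
  have := Continuous.ext_on (f := fun n => skT (t * I) φ ε σ u v n) (g := fun _ => (0:ℂ))
      ((skL_countable t 0).dense_compl ℂ) (by unfold skT; fun_prop) (by fun_prop) (by
        intro n hn
        refine step n (fun h => hn ?_) v
        simpa using h)
  exact congrFun this n

/-- symmetric product of `W`s -/
def skp (τ η : ℂ) (M : ℕ) (x : ℂ) : ℂ :=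
  ∏ k ∈ Finset.range M, skW τ (x + (2 * (k:ℂ) - (M - 1)) * η)

lemma skp_neg_eta (τ η : ℂ) (M : ℕ) (x : ℂ) : skp τ (-η) M x = skp τ η M x := by
  unfold skp
  rw [← Finset.prod_range_reflect]
  apply Finset.prod_congr rfl
  intro k hk
  have hk' : k + 1 ≤ M := Finset.mem_range.1 hk
  congr 1
  rw [show M - 1 - k = M - (k + 1) by omega]
  push_cast [Nat.cast_sub hk']
  ring

lemma skp_neg {τ : ℂ} (hτ : 0 < τ.im) (η : ℂ) (M : ℕ) (x : ℂ) : skp τ η M (-x) = skp τ η M x := by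
  rw [← skp_neg_eta τ η M x]
  unfold skp
  apply Finset.prod_congr rfl
  intro k hk
  rw [(sk_W_Q τ hτ).neg' (show -x + (2 * (k:ℂ) - (M - 1)) * η = -(x + (2 * (k:ℂ) - (M - 1)) * -η) by ring),
    one_mul]

lemma skp_add_one {τ : ℂ} (hτ : 0 < τ.im) (η : ℂ) (M : ℕ) (x : ℂ) :
    skp τ η M (x + 1) = skp τ η M x := by
  unfold skp
  apply Finset.prod_congr rfl
  intro k hk
  rw [add_right_comm, (sk_W_Q τ hτ).add_one, one_mul]

lemma sk_prod_E (τ η x b : ℂ) (M : ℕ) : ∏ k ∈ Finset.range M, skE τ (x + (2 * (k:ℂ) - b) * η) =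
    cexp (-(M * (2 * π * I * x + π * I * τ)) - 2 * π * I * η * (M * (M - 1) - M * b)) := by
  induction M with
  | zero => simp
  | succ M ih =>
    rw [Finset.prod_range_succ, ih, skE, ← Complex.exp_add]
    congr 1; push_cast; ring

lemma skp_add_tau {τ : ℂ} (hτ : 0 < τ.im) (η : ℂ) (M : ℕ) (x : ℂ) :
    skp τ η M (x + τ) = cexp (-(M * (2 * π * I * x + π * I * τ))) * skp τ η M x := by
  have e := sk_prod_E τ η x (M - 1) M
  rw [sub_self, mul_zero, sub_zero] at e
  rw [← e]
  unfold skp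
  rw [← Finset.prod_mul_distrib]
  apply Finset.prod_congr rfl
  intro k hk
  rw [add_right_comm, (sk_W_Q τ hτ).add_tau, one_mul]

lemma skp_succ (τ η : ℂ) (M : ℕ) (y : ℂ) :
    skp τ η (M + 1) y = skp τ η M (y - η) * skW τ (y + M * η) := by
  unfold skp
  rw [Finset.prod_range_succ]
  congr 1
  · apply Finset.prod_congr rfl
    intro k hk
    congr 1; push_cast; ring
  · congr 1; push_cast; ring

lemma skp_succ' (τ η : ℂ) (M : ℕ) (y : ℂ) :
    skp τ η (M + 1) y = skW τ (y - M * η) * skp τ η M (y + η) := by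
  unfold skp
  rw [Finset.prod_range_succ', mul_comm]
  congr 1
  · congr 1; push_cast; ring
  · apply Finset.prod_congr rfl
    intro k hk
    congr 1; push_cast; ring

lemma skp_diff {τ : ℂ} (hτ : 0 < τ.im) (η : ℂ) (M : ℕ) : Differentiable ℂ (skp τ η M) := by
  have := (sk_W_Q τ hτ).diff
  unfold skp
  intro x
  refine DifferentiableAt.fun_finsetProd (fun k _ => ?_)
  fun_prop

lemma ThetaSp.tau {τ : ℂ} {N : ℕ} {f : ℂ → ℂ} (hf : ThetaSp τ N f) (x : ℂ) :
    f (x + τ) = cexp (-(N * (4 * π * I * x + 2 * π * I * τ))) * f x := by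
  rw [hf.2.2.1]; congr 2; unfold cπ; ring

/-- left integrand -/
def skLL (τ : ℂ) (φ : ℂ → ℂ) (η : ℂ) (N : ℕ) (f G : ℂ → ℂ) (u v : ℂ) : ℂ :=
  φ (2*u - N*η) * f (u + η) * G v * θf τ (2*v) / (skp τ η (N+2) (u+v) * skp τ η (N+2) (u-v))

/-- right integrand -/
def skRR (τ : ℂ) (φ : ℂ → ℂ) (η : ℂ) (N : ℕ) (f G : ℂ → ℂ) (u v : ℂ) : ℂ :=
  φ (-2*v - N*η) * f u * G (v - η) * θf τ (2*u) / (skp τ η (N+2) (u+v) * skp τ η (N+2) (u-v))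

section
variable {τ : ℂ} {φ : ℂ → ℂ} {ε ρ₁ ρ₂ : ℂ}

lemma skRR_eq (hτ : 0 < τ.im) (h : SkQ τ φ ε ρ₁ ρ₂) (η : ℂ) (N : ℕ) (f G : ℂ → ℂ) (u v : ℂ) :
    skRR τ φ η N f G u v = ε * skLL τ φ (-η) N G f v u := by
  unfold skRR skLL
  rw [skp_neg_eta, skp_neg_eta, h.neg' (show -2*v - N*η = -(2*v - N * -η) by ring),
    show v - u = -(u - v) by ring, skp_neg hτ, add_comm v u, ← sub_eq_add_neg]
  ring

lemma skLL_u1 (hτ : 0 < τ.im) (h : SkQ τ φ ε ρ₁ ρ₂) (h1 : ρ₁ ^ 2 = 1) (η : ℂ) (N : ℕ) (f G : ℂ → ℂ)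
    (hf : ThetaSp τ N f) (u v : ℂ) :
    skLL τ φ η N f G (u + 1) v = skLL τ φ η N f G u v := by
  unfold skLL
  rw [show 2 * (u + 1) - N * η = 2 * u - N * η + 2 by ring, h.add_two h1, add_right_comm u 1 η,
    hf.2.1, add_right_comm u 1 v, skp_add_one hτ, show u + 1 - v = u - v + 1 by ring, skp_add_one hτ]

lemma skLL_v1 (hτ : 0 < τ.im) (η : ℂ) (N : ℕ) (f G : ℂ → ℂ)
    (hG : ThetaSp τ N G) (u v : ℂ) :
    skLL τ φ η N f G u (v + 1) = skLL τ φ η N f G u v := by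
  unfold skLL
  rw [hG.2.1, mul_add, mul_one, (sk_theta_Q τ hτ).add_two (by norm_num), ← add_assoc, skp_add_one hτ,
    ← skp_neg hτ _ _ (u - (v + 1)), show -(u - (v+1)) = -(u - v) + 1 by ring, skp_add_one hτ,
    skp_neg hτ]

lemma skLL_ut (hτ : 0 < τ.im) (h : SkQ τ φ ε ρ₁ ρ₂) (h2 : ρ₂ ^ 2 = 1) (η : ℂ) (N : ℕ) (f G : ℂ → ℂ)
    (hf : ThetaSp τ N f) (u v : ℂ) :
    skLL τ φ η N f G (u + τ) v = skLL τ φ η N f G u v := by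
  unfold skLL
  rw [show 2 * (u + τ) - N * η = 2 * u - N * η + 2 * τ by ring, h.add_two_tau h2,
    add_right_comm u τ η, hf.tau, add_right_comm u τ v, skp_add_tau hτ,
    show u + τ - v = u - v + τ by ring, skp_add_tau hτ]
  have e : cexp (-(4 * π * I * (2 * u - N * η)) - 4 * π * I * τ) *
      cexp (-(N * (4 * π * I * (u + η) + 2 * π * I * τ))) =
      cexp (-((N + 2 : ℕ) * (2 * π * I * (u + v) + π * I * τ))) *
      cexp (-((N + 2 : ℕ) * (2 * π * I * (u - v) + π * I * τ))) := by
    rw [← Complex.exp_add, ← Complex.exp_add]; congr 1; push_cast; ring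
  rw [← mul_div_mul_left _ (skp τ η (N+2) (u+v) * skp τ η (N+2) (u-v)) (mul_ne_zero
    (Complex.exp_ne_zero (-((N + 2 : ℕ) * (2 * π * I * (u + v) + π * I * τ))))
    (Complex.exp_ne_zero (-((N + 2 : ℕ) * (2 * π * I * (u - v) + π * I * τ)))))]
  congr 1
  · linear_combination φ (2*u - N*η) * f (u + η) * G v * θf τ (2*v) * e
  · ring

lemma skLL_vt (hτ : 0 < τ.im) (η : ℂ) (N : ℕ) (f G : ℂ → ℂ)
    (hG : ThetaSp τ N G) (u v : ℂ) :
    skLL τ φ η N f G u (v + τ) = skLL τ φ η N f G u v := by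
  unfold skLL
  rw [hG.tau, mul_add 2 v τ, (sk_theta_Q τ hτ).add_two_tau (by norm_num), ← add_assoc, skp_add_tau hτ,
    ← skp_neg hτ _ _ (u - (v + τ)), show -(u - (v+τ)) = -(u - v) + τ by ring, skp_add_tau hτ,
    skp_neg hτ]
  have e : cexp (-(N * (4 * π * I * v + 2 * π * I * τ))) *
      cexp (-(4 * π * I * (2 * v)) - 4 * π * I * τ) =
      cexp (-((N + 2 : ℕ) * (2 * π * I * (u + v) + π * I * τ))) *
      cexp (-((N + 2 : ℕ) * (2 * π * I * (-(u - v)) + π * I * τ))) := by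
    rw [← Complex.exp_add, ← Complex.exp_add]; congr 1; push_cast; ring
  rw [← mul_div_mul_left _ (skp τ η (N+2) (u+v) * skp τ η (N+2) (u-v)) (mul_ne_zero
    (Complex.exp_ne_zero (-((N + 2 : ℕ) * (2 * π * I * (u + v) + π * I * τ))))
    (Complex.exp_ne_zero (-((N + 2 : ℕ) * (2 * π * I * (-(u - v)) + π * I * τ)))))]
  congr 1
  · linear_combination φ (2*u - N*η) * f (u + η) * G v * θf τ (2*v) * e
  · ring

/-- the combined numerator -/
def skY (τ : ℂ) (φ : ℂ → ℂ) (σ n s x : ℂ) : ℂ :=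
  φ (2*s+x-n) * θf τ (2*s-x) * skW τ (2*s+n) + σ * φ (-2*s+x-n) * θf τ (2*s+x) * skW τ (2*s-n)

lemma skY_add_one (hτ : 0 < τ.im) (h : SkQ τ φ ε ρ₁ ρ₂) (σ n s x : ℂ) :
    skY τ φ σ n s (x + 1) = -ρ₁ * skY τ φ σ n s x := by
  have hθ := sk_theta_Q τ hτ
  unfold skY
  rw [show 2*s+(x+1)-n = 2*s+x-n+1 by ring, show -2*s+(x+1)-n = -2*s+x-n+1 by ring, h.add_one,
    h.add_one, ← add_assoc, hθ.add_one, show 2*s-(x+1) = 2*s-x-1 by ring, hθ.sub_one (by norm_num)]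
  ring

lemma skY_add_tau (hτ : 0 < τ.im) (h : SkQ τ φ ε ρ₁ ρ₂) (σ n s x : ℂ) :
    skY τ φ σ n s (x + τ) = -ρ₂ * cexp (-(4 * π * I * x) + 2 * π * I * n - 2 * π * I * τ) *
      skY τ φ σ n s x := by
  have hθ := sk_theta_Q τ hτ
  unfold skY
  rw [show 2*s+(x+τ)-n = 2*s+x-n+τ by ring, show -2*s+(x+τ)-n = -2*s+x-n+τ by ring, h.add_tau,
    h.add_tau, ← add_assoc, hθ.add_tau, show 2*s-(x+τ) = 2*s-x-τ by ring, hθ.sub_tau (by norm_num)]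
  have e1 : skE τ (2*s+x-n) * cexp (2 * π * I * (2*s-x) - π * I * τ) =
      cexp (-(4 * π * I * x) + 2 * π * I * n - 2 * π * I * τ) := by
    rw [skE, ← Complex.exp_add]; congr 1; ring
  have e2 : skE τ (-2*s+x-n) * skE τ (2*s+x) =
      cexp (-(4 * π * I * x) + 2 * π * I * n - 2 * π * I * τ) := by
    rw [skE, skE, ← Complex.exp_add]; congr 1; ring
  linear_combination -ρ₂ * φ (2*s+x-n) * θf τ (2*s-x) * skW τ (2*s+n) * e1
    - ρ₂ * σ * φ (-2*s+x-n) * θf τ (2*s+x) * skW τ (2*s-n) * e2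

lemma sk_theta_c (τ x : ℂ) : θf τ (x + (1/2 + τ/2)) = cexp (-(π * I * x)) * skW τ x := by
  unfold skW
  rw [← mul_assoc, ← Complex.exp_add, neg_add_cancel, Complex.exp_zero, one_mul, add_assoc]

lemma skY_c (hτ : 0 < τ.im) (h : SkQ τ φ ε ρ₁ ρ₂) (hε : ε ^ 2 = 1) (σ : ℂ) (hσ2 : σ ^ 2 = 1)
    (hσ : ρ₁ * ρ₂ = -(σ * ε)) (n s : ℂ) :
    skY τ φ σ n s (n + (1/2 + τ/2)) = 0 := by
  have hθ := sk_theta_Q τ hτ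
  unfold skY
  rw [hθ.neg' (show 2*s - (n + (1/2+τ/2)) = -(-(2*s - n) + (1/2+τ/2)) by ring), sk_theta_c,
    (sk_W_Q τ hτ).neg, show 2*s + (n + (1/2+τ/2)) = 2*s+n+(1/2+τ/2) by ring, sk_theta_c,
    show 2*s + n + (1/2+τ/2) - n = 2*s + (1/2+τ/2) by ring,
    show -2*s + (n + (1/2+τ/2)) - n = -(2*s + (1/2+τ/2)) + τ + 1 by ring, h.add_one, h.add_tau,
    h.neg]
  have e : skE τ (-(2*s + (1/2+τ/2))) * cexp (-(π * I * (2*s+n))) =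
      - cexp (-(π * I * -(2*s-n))) := by
    rw [skE, ← Complex.exp_add]
    apply sk_exp_neg _ _ 0
    push_cast; ring
  set D := cexp (-(π * I * -(2*s-n)))
  linear_combination skW τ (2*s+n) * skW τ (2*s-n) * φ (2*s + (1/2+τ/2)) *
    (σ * ρ₁ * ρ₂ * ε * e - D * (σ * ε * hσ - σ ^ 2 * hε - hσ2))

end

lemma skY_div (t : ℝ) (ht : 0 < t) {φ : ℂ → ℂ} {ε ρ₁ ρ₂ : ℂ}
    (h : SkQ (t * I) φ ε ρ₁ ρ₂) (hε : ε ^ 2 = 1) (h1 : ρ₁ ^ 2 = 1)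
    (h2 : ρ₂ ^ 2 = 1) (σ : ℂ) (hσ2 : σ ^ 2 = 1) (hσ : ρ₁ * ρ₂ = -(σ * ε)) (n s : ℂ) :
    ∃ q : ℂ → ℂ, Differentiable ℂ q ∧ ∀ x, skY (t * I) φ σ n s x = skW (t * I) (1 * x + -n) * q x := by
  have hτ : 0 < (t * I : ℂ).im := by simpa using ht
  have hφd := h.diff
  have hθd := (sk_theta_Q _ hτ).diff
  have hWd := (sk_W_Q _ hτ).diff
  refine sk_div _ _ (by fun_prop) (by unfold skY; fun_prop)
    (sk_simple_comp _ hWd (sk_W_simple t ht) 1 _ one_ne_zero) ?_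
  intro x hx
  obtain ⟨m, k, e⟩ := sk_W_zero t ht _ hx
  have r1 : ρ₁ ≠ 0 := by rintro rfl; norm_num at h1
  have r2 : ρ₂ ≠ 0 := by rintro rfl; norm_num at h2
  rw [show x = (n + (1/2 + t * I/2)) + m + k * (t * I) by linear_combination e]
  refine (sk_lat (t * I) (fun x => skY (t * I) φ σ n s x = 0) (fun x => ?_) (fun x => ?_) m k _).2 ?_
  · rw [skY_add_one hτ h]; simp [r1]
  · rw [skY_add_tau hτ h]; simp [r2]
  · exact skY_c hτ h hε σ hσ2 hσ n s

/-- the quotient function, with its properties -/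
lemma sk_q (t : ℝ) (ht : 0 < t) {φ : ℂ → ℂ} {ε ρ₁ ρ₂ : ℂ}
    (h : SkQ (t * I) φ ε ρ₁ ρ₂) (hε : ε ^ 2 = 1) (h1 : ρ₁ ^ 2 = 1)
    (h2 : ρ₂ ^ 2 = 1) (σ : ℂ) (hσ2 : σ ^ 2 = 1) (hσ : ρ₁ * ρ₂ = -(σ * ε)) (n : ℂ) :
    ∃ q : ℂ → ℂ → ℂ, (∀ s, Differentiable ℂ (q s)) ∧
      (∀ s x, skY (t * I) φ σ n s x = skW (t * I) (x - n) * q s x) ∧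
      (∀ s x, q s (x + 2) = q s x) ∧
      (∀ s x, q s (x + 2 * (t * I)) = cexp (-(4 * π * I * x) - 4 * π * I * (t * I)) * q s x) ∧
      (∀ s x, q (-s) (-x) = - q s x) := by
  have hτ : 0 < (t * I : ℂ).im := by simpa using ht
  have hW := sk_W_Q _ hτ
  have hθ := sk_theta_Q _ hτ
  choose q hq hqY using skY_div t ht h hε h1 h2 σ hσ2 hσ n
  have hqY' : ∀ s x, skY (t * I) φ σ n s x = skW (t * I) (x - n) * q s x := fun s x => by
    rw [hqY]; congr 2; ring
  have hqc : ∀ s, Continuous (q s) := fun s => (hq s).continuous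
  have dense1 : ∀ b : ℂ, Dense {x : ℂ | skW (t * I) (x + b) ≠ 0} := by
    intro b
    apply sk_dense t 1 b one_ne_zero (1/2 + t * I / 2)
    intro z hz
    rw [one_mul]
    exact sk_W_zero t ht _ (by simpa using hz)
  have cancel : ∀ (b : ℂ) (F H : ℂ → ℂ), Continuous F → Continuous H →
      (∀ x, skW (t * I) (x + b) * F x = skW (t * I) (x + b) * H x) → ∀ x, F x = H x := by
    intro b F H hF hH e x
    refine congrFun (Continuous.ext_on (dense1 b) hF hH ?_) x
    intro x hx
    exact mul_left_cancel₀ hx (e x)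
  have q1 : ∀ s x, q s (x + 1) = -ρ₁ * q s x := by
    intro s
    refine cancel (-n) (fun x => q s (x + 1)) (fun x => -ρ₁ * q s x) (by have := hqc s; fun_prop)
      (by have := hqc s; fun_prop) ?_
    intro x
    have := skY_add_one hτ h σ n s x
    rw [hqY', hqY', show x + 1 - n = x - n + 1 by ring, hW.add_one] at this
    rw [← sub_eq_add_neg]
    linear_combination this
  have q2 : ∀ s x, q s (x + t * I) = -ρ₂ * skE (t * I) x * q s x := by
    intro s
    refine cancel (-n) (fun x => q s (x + t * I)) (fun x => -ρ₂ * skE (t * I) x * q s x)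
      (by have := hqc s; fun_prop)
      (by have := hqc s; unfold skE; fun_prop) ?_
    intro x
    have := skY_add_tau hτ h σ n s x
    rw [hqY', hqY', show x + t * I - n = x - n + t * I by ring, hW.add_tau] at this
    have e : cexp (-(4 * π * I * x) + 2 * π * I * n - 2 * π * I * (t * I)) =
      skE (t * I) (x - n) * skE (t * I) x := by
      rw [skE, skE, ← Complex.exp_add]; congr 1; ring
    rw [e] at this
    rw [← sub_eq_add_neg]
    apply mul_left_cancel₀ (skE_ne (t * I) (x - n))
    linear_combination this
  refine ⟨q, hq, hqY', ?_, ?_, ?_⟩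
  · intro s x
    rw [show x + 2 = x + 1 + 1 by ring, q1, q1]
    linear_combination q s x * h1
  · intro s x
    rw [show x + 2 * (t * I) = x + t * I + t * I by ring, q2, q2]
    have e : skE (t * I) (x + t * I) * skE (t * I) x = cexp (-(4 * π * I * x) - 4 * π * I * (t * I)) := by
      rw [skE, skE, ← Complex.exp_add]; congr 1; ring
    rw [← e]
    linear_combination skE (t * I) (x + t * I) * skE (t * I) x * q s x * h2
  · intro s
    have hc1 := hqc s
    have hc2 := hqc (-s)
    have hWc := hW.diff.continuous
    refine cancel n (fun x => q (-s) (-x)) (fun x => - q s x) (by fun_prop) (by fun_prop) ?_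
    refine cancel (-n) (fun x => skW (t * I) (x + n) * q (-s) (-x))
      (fun x => skW (t * I) (x + n) * (- q s x)) (by fun_prop) (by fun_prop) ?_
    intro x
    have hT := skT_zero t ht h hε h1 h2 σ hσ (s + x/2) (s - x/2) n
    have a := hqY' (-s) (-x)
    have b := hqY' s x
    rw [← sub_eq_add_neg]
    unfold skT at hT
    unfold skY at a b
    rw [show 2 * -s + -x - n = -(2*s+x+n) by ring, h.neg, show 2 * -s - -x = -(2*s-x) by ring, hθ.neg,
      show 2 * -s + n = -(2*s-n) by ring, hW.neg, show -2 * -s + -x - n = 2*s-x-n by ring,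
      show 2 * -s + -x = -(2*s+x) by ring, hθ.neg, show 2 * -s - n = -(2*s+n) by ring, hW.neg,
      show -x - n = -(x+n) by ring, hW.neg] at a
    rw [h.neg' (show -2*s+x-n = -(2*s-x+n) by ring)] at b
    rw [show 2 * (s + x/2) = 2*s+x by ring, show 2 * (s - x/2) = 2*s-x by ring,
      show s + x/2 + (s - x/2) = 2*s by ring, show s + x/2 - (s - x/2) = x by ring] at hT
    linear_combination - skW (t * I) (x - n) * a - skW (t * I) (x + n) * b + hT

/-- the two possible orderings of the periods -/
def skOm (t : ℝ) (ω₁ ω₂ : ℂ) : Prop := (ω₁ = 1 ∧ ω₂ = t * I) ∨ (ω₁ = t * I ∧ ω₂ = 1)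

lemma sk_half_int (ρ : ℝ) (h : |ρ| < 1/2) (m : ℤ) : ρ ≠ 1/2 + m := by
  intro e
  rw [abs_lt] at h
  have h1 : (m : ℝ) < 0 := by linarith
  have h2 : (-1 : ℝ) < m := by linarith
  have h1' : m < 0 := by exact_mod_cast h1
  have h2' : -1 < m := by exact_mod_cast h2
  omega

lemma sk_geo_B {t : ℝ} (ht : 0 < t) {ω₁ ω₂ : ℂ} (hω : skOm t ω₁ ω₂) (b ρ : ℝ) (hρ : |ρ| < 1/2) :
    skW (t * I) (ω₂ * b + ω₁ * ρ) ≠ 0 := by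
  intro h0
  obtain ⟨m, k, e⟩ := sk_W_zero t ht _ h0
  rcases hω with ⟨rfl, rfl⟩ | ⟨rfl, rfl⟩
  · have := congrArg Complex.re e
    simp at this
    exact sk_half_int ρ hρ m (by linarith)
  · have := congrArg Complex.im e
    simp at this
    refine sk_half_int ρ hρ k ?_
    apply mul_left_cancel₀ ht.ne'
    linarith

lemma sk_geo_A {t : ℝ} (ht : 0 < t) {ω₁ ω₂ : ℂ} (hω : skOm t ω₁ ω₂) (a : ℝ) :
    skW (t * I) (ω₁ * a) ≠ 0 := by
  have h := sk_geo_B ht (ω₁ := ω₂) (ω₂ := ω₁) (by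
    rcases hω with ⟨h, h'⟩ | ⟨h, h'⟩
    · exact Or.inr ⟨h', h⟩
    · exact Or.inl ⟨h', h⟩) a 0 (by norm_num)
  simpa using h

lemma sk_geo_rot {t : ℝ} (ht : 0 < t) {ω₁ ω₂ : ℂ} (hω : skOm t ω₁ ω₂) :
    ∃ κ : ℝ, κ ≠ 0 ∧ ω₁ = ω₂ * (κ * I) := by
  have ht' : (t : ℂ) ≠ 0 := by exact_mod_cast ht.ne'
  rcases hω with ⟨rfl, rfl⟩ | ⟨rfl, rfl⟩
  · refine ⟨-1/t, by simp [ht.ne'], ?_⟩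
    push_cast
    field_simp
    rw [I_sq]; ring
  · exact ⟨t, ht.ne', by ring⟩

lemma skp_ne_A {t : ℝ} (ht : 0 < t) {ω₁ ω₂ : ℂ} (hω : skOm t ω₁ ω₂) (r a : ℝ) (M : ℕ) :
    skp (t * I) (ω₁ * r) M (ω₁ * a) ≠ 0 := by
  unfold skp
  rw [Finset.prod_ne_zero_iff]
  intro k hk
  have := sk_geo_A ht hω (a + (2 * (k:ℝ) - (M - 1)) * r)
  convert this using 2
  push_cast; ring

lemma skp_ne_B {t : ℝ} (ht : 0 < t) {ω₁ ω₂ : ℂ} (hω : skOm t ω₁ ω₂) (r b ρ : ℝ) (M : ℕ)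
    (h : |ρ| + (M - 1) * |r| < 1/2) :
    skp (t * I) (ω₁ * r) M (ω₂ * b + ω₁ * ρ) ≠ 0 := by
  unfold skp
  rw [Finset.prod_ne_zero_iff]
  intro k hk
  have hk' : (k : ℝ) + 1 ≤ M := by exact_mod_cast Finset.mem_range.1 hk
  have hk0 : (0 : ℝ) ≤ k := by positivity
  have := sk_geo_B ht hω b (ρ + (2 * (k:ℝ) - (M - 1)) * r) (by
    refine lt_of_le_of_lt ((abs_add_le _ _).trans ?_) h
    gcongr
    rw [abs_mul]
    gcongr
    rw [abs_le]; constructor <;> linarith)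
  convert this using 2
  push_cast; ring

section
variable {t : ℝ} {φ : ℂ → ℂ} {ε ρ₁ ρ₂ : ℂ} {N : ℕ} {f G : ℂ → ℂ} {ω₁ ω₂ : ℂ}

lemma skLL_per (ht : 0 < t) (h : SkQ (t * I) φ ε ρ₁ ρ₂) (h1 : ρ₁ ^ 2 = 1) (h2 : ρ₂ ^ 2 = 1) (η : ℂ)
    (hf : ThetaSp (t * I) N f) (hG : ThetaSp (t * I) N G) (ω : ℂ) (hω : ω = 1 ∨ ω = t * I) (u v : ℂ) :
    skLL (t * I) φ η N f G (u + ω) (v + ω) = skLL (t * I) φ η N f G u v ∧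
    skLL (t * I) φ η N f G (u + ω) (v - ω) = skLL (t * I) φ η N f G u v ∧
    skLL (t * I) φ η N f G (u - ω) (v + ω) = skLL (t * I) φ η N f G u v := by
  have hτ : 0 < (t * I : ℂ).im := by simpa using ht
  have e1 : ∀ u v, skLL (t * I) φ η N f G (u + ω) v = skLL (t * I) φ η N f G u v := by
    rcases hω with rfl | rfl
    · exact skLL_u1 hτ h h1 η N f G hf
    · exact skLL_ut hτ h h2 η N f G hf
  have e2 : ∀ u v, skLL (t * I) φ η N f G u (v + ω) = skLL (t * I) φ η N f G u v := by
    rcases hω with rfl | rfl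
    · exact skLL_v1 hτ η N f G hG
    · exact skLL_vt hτ η N f G hG
  refine ⟨by rw [e1, e2], ?_, ?_⟩
  · rw [e1, ← e2 u (v - ω), sub_add_cancel]
  · rw [e2, ← e1 (u - ω) v, sub_add_cancel]

lemma skRR_per (ht : 0 < t) (h : SkQ (t * I) φ ε ρ₁ ρ₂) (h1 : ρ₁ ^ 2 = 1) (h2 : ρ₂ ^ 2 = 1) (η : ℂ)
    (hf : ThetaSp (t * I) N f) (hG : ThetaSp (t * I) N G) (ω : ℂ) (hω : ω = 1 ∨ ω = t * I) (u v : ℂ) :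
    skRR (t * I) φ η N f G (u + ω) (v + ω) = skRR (t * I) φ η N f G u v ∧
    skRR (t * I) φ η N f G (u + ω) (v - ω) = skRR (t * I) φ η N f G u v := by
  have hτ : 0 < (t * I : ℂ).im := by simpa using ht
  have := skLL_per ht h h1 h2 (-η) hG hf ω hω v u
  rw [skRR_eq hτ h, skRR_eq hτ h, skRR_eq hτ h, this.1, this.2.2]
  exact ⟨rfl, rfl⟩

lemma skOm.left (hω : skOm t ω₁ ω₂) : ω₁ = 1 ∨ ω₁ = t * I := by
  rcases hω with ⟨h, _⟩ | ⟨h, _⟩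
  · exact Or.inl h
  · exact Or.inr h

lemma skOm.right (hω : skOm t ω₁ ω₂) : ω₂ = 1 ∨ ω₂ = t * I := by
  rcases hω with ⟨_, h⟩ | ⟨_, h⟩
  · exact Or.inr h
  · exact Or.inl h

lemma sk_r_bound (r : ℝ) (N : ℕ) (hr : |r| < 1 / (2 * (N + 1))) : (N + 1) * |r| < 1/2 := by
  have : (0 : ℝ) < 2 * (N + 1) := by positivity
  rw [lt_div_iff₀ this] at hr
  linarith

lemma skLL_cont (ht : 0 < t) (h : SkQ (t * I) φ ε ρ₁ ρ₂)
    (hf : ThetaSp (t * I) N f) (hG : ThetaSp (t * I) N G) (hω : skOm t ω₁ ω₂) (r : ℝ)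
    (hr : |r| < 1 / (2 * (N + 1))) :
    Continuous (fun p : ℝ × ℝ => skLL (t * I) φ (ω₁ * r) N f G (ω₁ * p.1 + ω₂ * p.2)
      (ω₁ * p.1 - ω₂ * p.2)) := by
  have hτ : 0 < (t * I : ℂ).im := by simpa using ht
  have hφ := h.diff.continuous
  have hθ := (sk_theta_Q _ hτ).diff.continuous
  have hp := (skp_diff hτ (ω₁ * r) (N + 2)).continuous
  have hfc := hf.1.continuous
  have hGc := hG.1.continuous
  unfold skLL
  refine Continuous.div (by fun_prop) (by fun_prop) ?_
  rintro ⟨a, b⟩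
  refine mul_ne_zero ?_ ?_
  · have := skp_ne_A ht hω r (2 * a) (N + 2)
    convert this using 2
    push_cast; ring
  · have hb := sk_r_bound r N hr
    have := skp_ne_B ht hω r (2 * b) 0 (N + 2) (by push_cast; rw [abs_zero]; linarith)
    convert this using 2
    push_cast; ring

lemma skRR_cont (ht : 0 < t) (h : SkQ (t * I) φ ε ρ₁ ρ₂)
    (hf : ThetaSp (t * I) N f) (hG : ThetaSp (t * I) N G) (hω : skOm t ω₁ ω₂) (r : ℝ)
    (hr : |r| < 1 / (2 * (N + 1))) :
    Continuous (fun p : ℝ × ℝ => skRR (t * I) φ (ω₁ * r) N f G (ω₁ * p.1 + ω₂ * p.2)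
      (ω₁ * p.1 - ω₂ * p.2)) := by
  have hτ : 0 < (t * I : ℂ).im := by simpa using ht
  have := skLL_cont ht h hG hf hω (-r) (by rwa [abs_neg])
  have h3 := (this.comp (show Continuous fun p : ℝ × ℝ => (p.1, -p.2) by fun_prop)).const_mul ε
  refine h3.congr ?_
  rintro ⟨a, b⟩
  rw [skRR_eq hτ h]
  simp only [Function.comp]
  push_cast
  congr 2 <;> ring

/-- the key algebraic identity after dividing out -/
lemma skJ_eq (hτ : 0 < (t * I : ℂ).im) (σ η : ℂ) (s z : ℂ) (Q : ℂ)
    (hQ : skY (t * I) φ σ ((N + 2) * η) s (2 * z) = skW (t * I) (2 * z - (N + 2) * η) * Q)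
    (hA : skp (t * I) η (N + 3) (2 * s) ≠ 0) (hB : skp (t * I) η (N + 2) (2 * z - η) ≠ 0) :
    skLL (t * I) φ η N f G (s + (z - η/2) - η/2) (s - (z - η/2) - η/2) +
      σ * skRR (t * I) φ η N f G (s + (z - η/2) + η/2) (s - (z - η/2) + η/2) =
    f (s + z) * G (s - z) * Q / (skp (t * I) η (N + 3) (2 * s) * skp (t * I) η (N + 1) (2 * z)) := by
  unfold skLL skRR
  have a1 := skp_succ (t * I) η (N + 2) (2 * s)
  have a2 := skp_succ' (t * I) η (N + 2) (2 * s)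
  have b := skp_succ' (t * I) η (N + 1) (2 * z - η)
  rw [show 2 * z - η - (N + 1 : ℕ) * η = 2 * z - (N + 2) * η by push_cast; ring, sub_add_cancel] at b
  rw [show s + (z - η/2) - η/2 + (s - (z - η/2) - η/2) = 2 * s - η by ring,
    show s + (z - η/2) - η/2 - (s - (z - η/2) - η/2) = 2 * z - η by ring,
    show s + (z - η/2) + η/2 + (s - (z - η/2) + η/2) = 2 * s + η by ring,
    show s + (z - η/2) + η/2 - (s - (z - η/2) + η/2) = 2 * z - η by ring,
    show 2 * (s + (z - η/2) - η/2) - N * η = 2 * s + 2 * z - (N + 2) * η by ring,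
    show s + (z - η/2) - η/2 + η = s + z by ring,
    show s - (z - η/2) - η/2 = s - z by ring, show s + (z - η/2) + η/2 = s + z by ring,
    show s - (z - η/2) + η/2 - η = s - z by ring,
    show -2 * (s - (z - η/2) + η/2) - N * η = -2 * s + 2 * z - (N + 2) * η by ring,
    show 2 * (s - z) = 2 * s - 2 * z by ring, show 2 * (s + z) = 2 * s + 2 * z by ring]
  unfold skY at hQ
  rw [show ((N + 2 : ℕ) : ℂ) = N + 2 by push_cast; ring] at a1 a2
  have hA1 := hA
  have hA2 := hA
  rw [show N + 3 = N + 2 + 1 by ring] at hA hA1 hA2 ⊢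
  rw [a1] at hA1
  rw [a2] at hA2
  rw [show N + 2 = N + 1 + 1 by ring, b] at hB
  have p1 := left_ne_zero_of_mul hA1
  have w1 := right_ne_zero_of_mul hA1
  have w2 := left_ne_zero_of_mul hA2
  have p2 := right_ne_zero_of_mul hA2
  have w3 := left_ne_zero_of_mul hB
  have p3 := right_ne_zero_of_mul hB
  rw [show skp (t * I) η (N + 2) (2 * z - η) = _ from b]
  generalize skp (t * I) η (N + 2 + 1) (2 * s) = A at *
  generalize skp (t * I) η (N + 2) (2 * s - η) = P1 at *
  generalize skp (t * I) η (N + 2) (2 * s + η) = P2 at *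
  generalize skp (t * I) η (N + 1) (2 * z) = P3 at *
  generalize skW (t * I) (2 * s + (N + 2) * η) = W1 at *
  generalize skW (t * I) (2 * s - (N + 2) * η) = W2 at *
  generalize skW (t * I) (2 * z - (N + 2) * η) = W3 at *
  rw [← mul_div_assoc, div_add_div _ _ (mul_ne_zero p1 hB) (mul_ne_zero p2 hB),
    div_eq_div_iff (mul_ne_zero (mul_ne_zero p1 hB) (mul_ne_zero p2 hB)) (mul_ne_zero hA p3)]
  generalize φ (2 * s + 2 * z - (N + 2) * η) = F1 at *
  generalize φ (-2 * s + 2 * z - (N + 2) * η) = F2 at *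
  generalize θf (t * I) (2 * s - 2 * z) = T1 at *
  generalize θf (t * I) (2 * s + 2 * z) = T2 at *
  generalize f (s + z) = X at *
  generalize G (s - z) = Z at *
  linear_combination X * Z * W3 * P3 ^ 2 * (P1 * P2 * hQ + F1 * T1 * P2 * a1
    + σ * F2 * T2 * P1 * a2)

end

/-- kernel -/
def skk (τ η : ℂ) (N : ℕ) (f G : ℂ → ℂ) (q : ℂ → ℂ → ℂ) (s z : ℂ) : ℂ :=
  f (s + z) * G (s - z) * q s (2 * z) / (skp τ η (N + 3) (2 * s) * skp τ η (N + 1) (2 * z))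

lemma ThetaSp.sub_one {τ : ℂ} {N : ℕ} {f : ℂ → ℂ} (hf : ThetaSp τ N f) (x : ℂ) :
    f (x - 1) = f x := by
  rw [← hf.2.1, sub_add_cancel]

lemma ThetaSp.sub_tau {τ : ℂ} {N : ℕ} {f : ℂ → ℂ} (hf : ThetaSp τ N f) (x : ℂ) :
    f (x - τ) = cexp (N * (4 * π * I * x - 2 * π * I * τ)) * f x := by
  have := hf.tau (x - τ)
  rw [sub_add_cancel] at this
  rw [this, ← mul_assoc, ← Complex.exp_add, show (N * (4 * π * I * x - 2 * π * I * τ) +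
    -(N * (4 * π * I * (x - τ) + 2 * π * I * τ)) : ℂ) = 0 by ring, Complex.exp_zero, one_mul]

section
variable {t : ℝ} {φ : ℂ → ℂ} {ε ρ₁ ρ₂ : ℂ} {N : ℕ} {f G : ℂ → ℂ} {ω₁ ω₂ : ℂ} {q : ℂ → ℂ → ℂ}

lemma skk_one {τ : ℂ} (hτ : 0 < τ.im) (η : ℂ) (hf : ThetaSp τ N f) (hG : ThetaSp τ N G)
    (hq1 : ∀ s x, q s (x + 2) = q s x) (s z : ℂ) :
    skk τ η N f G q s (z + 1) = skk τ η N f G q s z := by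
  unfold skk
  rw [← add_assoc, hf.2.1, ← sub_sub, hG.sub_one, mul_add, mul_one, hq1,
    show 2 * z + 2 = 2 * z + 1 + 1 by ring, skp_add_one hτ, skp_add_one hτ]

lemma skk_tau {τ : ℂ} (hτ : 0 < τ.im) (η : ℂ) (hf : ThetaSp τ N f) (hG : ThetaSp τ N G)
    (hq2 : ∀ s x, q s (x + 2 * τ) = cexp (-(4 * π * I * x) - 4 * π * I * τ) * q s x) (s z : ℂ) :
    skk τ η N f G q s (z + τ) = skk τ η N f G q s z := by
  unfold skk
  rw [← add_assoc, hf.tau, ← sub_sub, hG.sub_tau, mul_add 2 z τ, hq2,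
    show 2 * z + 2 * τ = 2 * z + τ + τ by ring, skp_add_tau hτ, skp_add_tau hτ]
  have e : cexp (-(N * (4 * π * I * (s + z) + 2 * π * I * τ))) *
      cexp (N * (4 * π * I * (s - z) - 2 * π * I * τ)) *
      cexp (-(4 * π * I * (2 * z)) - 4 * π * I * τ) =
      cexp (-((N + 1 : ℕ) * (2 * π * I * (2 * z + τ) + π * I * τ))) *
      cexp (-((N + 1 : ℕ) * (2 * π * I * (2 * z) + π * I * τ))) := by
    rw [← Complex.exp_add, ← Complex.exp_add, ← Complex.exp_add]; congr 1; push_cast; ring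
  rw [← mul_div_mul_left _ (skp τ η (N+3) (2*s) * skp τ η (N+1) (2*z)) (mul_ne_zero
    (Complex.exp_ne_zero (-((N + 1 : ℕ) * (2 * π * I * (2 * z + τ) + π * I * τ))))
    (Complex.exp_ne_zero (-((N + 1 : ℕ) * (2 * π * I * (2 * z) + π * I * τ)))))]
  congr 1
  · linear_combination f (s + z) * G (s - z) * q s (2 * z) * e
  · ring

lemma skk_neg {τ : ℂ} (hτ : 0 < τ.im) (η : ℂ) (hf : ThetaSp τ N f) (hG : ThetaSp τ N G)
    (hq3 : ∀ s x, q (-s) (-x) = - q s x) (s z : ℂ) :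
    skk τ η N f G q (-s) (-z) = - skk τ η N f G q s z := by
  unfold skk
  rw [show -s + -z = -(s + z) by ring, hf.2.2.2, show -s - -z = -(s - z) by ring, hG.2.2.2,
    mul_neg, mul_neg, hq3, skp_neg hτ, skp_neg hτ]
  ring

/-- bookkeeping with periodic continuous functions -/
lemma sk_abs (L R : ℝ → ℝ → ℂ) (σ : ℂ) (r : ℝ) (hcL' : Continuous fun p : ℝ × ℝ => L p.1 p.2)
    (hcR' : Continuous fun p : ℝ × ℝ => R p.1 p.2) (pL : ∀ a b, L (a + 1) b = L a b)
    (pR : ∀ a b, R (a + 1) b = R a b)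
    (hA0 : ∫ a in (0:ℝ)..1, ∫ b in (0:ℝ)..1, (L (a - r/2) b + σ * R (a + r/2) b) = 0) :
    ∫ b in (0:ℝ)..1, ∫ a in (0:ℝ)..1, L a b = -σ * ∫ b in (0:ℝ)..1, ∫ a in (0:ℝ)..1, R a b := by
  have hJc : Continuous (Function.uncurry fun a b => L (a - r/2) b + σ * R (a + r/2) b) := by
    have c1 := hcL'.comp (show Continuous fun p : ℝ × ℝ => (p.1 - r/2, p.2) by fun_prop)
    have c2 := hcR'.comp (show Continuous fun p : ℝ × ℝ => (p.1 + r/2, p.2) by fun_prop)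
    exact c1.add (c2.const_mul σ)
  rw [← sk_swap _ hJc] at hA0
  have inner : ∀ b : ℝ, ∫ a in (0:ℝ)..1, (L (a - r/2) b + σ * R (a + r/2) b) =
      (∫ a in (0:ℝ)..1, L a b) + σ * ∫ a in (0:ℝ)..1, R a b := by
    intro b
    have cL : Continuous fun a : ℝ => L a b :=
      hcL'.comp (show Continuous fun a : ℝ => (a, b) by fun_prop)
    have cR : Continuous fun a : ℝ => R a b :=
      hcR'.comp (show Continuous fun a : ℝ => (a, b) by fun_prop)
    rw [intervalIntegral.integral_add, intervalIntegral.integral_const_mul]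
    · congr 1
      · rw [intervalIntegral.integral_comp_sub_right (fun a => L a b)]
        have := Function.Periodic.intervalIntegral_add_eq (f := fun a => L a b) (T := 1)
          (fun a => pL a b) (0 - r/2) 0
        rw [zero_add] at this
        rw [← this]
        congr 1; ring
      · congr 1
        rw [intervalIntegral.integral_comp_add_right (fun a => R a b)]
        have := Function.Periodic.intervalIntegral_add_eq (f := fun a => R a b) (T := 1)
          (fun a => pR a b) (0 + r/2) 0
        rw [zero_add, zero_add] at this
        rw [zero_add, ← this]
        congr 1; ring
    · exact (cL.comp (by fun_prop : Continuous fun a : ℝ => a - r/2)).intervalIntegrable _ _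
    · exact ((cR.comp (by fun_prop : Continuous fun a : ℝ => a + r/2)).const_mul σ).intervalIntegrable _ _
  simp only [inner] at hA0
  rw [intervalIntegral.integral_add, intervalIntegral.integral_const_mul] at hA0
  · linear_combination hA0
  · apply Continuous.intervalIntegrable
    exact intervalIntegral.continuous_parametric_intervalIntegral_of_continuous'
      (f := fun b a => L a b) (hcL'.comp continuous_swap) 0 1
  · apply Continuous.intervalIntegrable
    exact (intervalIntegral.continuous_parametric_intervalIntegral_of_continuous'
      (f := fun b a => R a b) (hcR'.comp continuous_swap) 0 1).const_mul σ

set_option maxHeartbeats 1000000 in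
/-- the core identity -/
lemma sk_core (ht : 0 < t) (h : SkQ (t * I) φ ε ρ₁ ρ₂) (hε : ε ^ 2 = 1) (h1 : ρ₁ ^ 2 = 1)
    (h2 : ρ₂ ^ 2 = 1) (σ : ℂ) (hσ2 : σ ^ 2 = 1) (hσ : ρ₁ * ρ₂ = -(σ * ε))
    (hf : ThetaSp (t * I) N f) (hG : ThetaSp (t * I) N G) (hω : skOm t ω₁ ω₂) (r : ℝ)
    (hr : |r| < 1 / (2 * (N + 1))) :
    ∫ b in (0:ℝ)..1, ∫ a in (0:ℝ)..1, skLL (t * I) φ (ω₁ * r) N f G (ω₁ * a + ω₂ * b) (ω₁ * a - ω₂ * b)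
    = -σ * ∫ b in (0:ℝ)..1, ∫ a in (0:ℝ)..1,
        skRR (t * I) φ (ω₁ * r) N f G (ω₁ * a + ω₂ * b) (ω₁ * a - ω₂ * b) := by
  have hτ : 0 < (t * I : ℂ).im := by simpa using ht
  have hb := sk_r_bound r N hr
  have hr0 := abs_nonneg r
  have hcL := skLL_cont ht h hf hG hω r hr
  have hcR := skRR_cont ht h hf hG hω r hr
  have hpL := skLL_per ht h h1 h2 (ω₁ * r) hf hG ω₁ hω.left
  have hpR := skRR_per ht h h1 h2 (ω₁ * r) hf hG ω₁ hω.left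
  set L : ℝ → ℝ → ℂ := fun a b =>
    skLL (t * I) φ (ω₁ * r) N f G (ω₁ * a + ω₂ * b) (ω₁ * a - ω₂ * b) with hL
  set R : ℝ → ℝ → ℂ := fun a b =>
    skRR (t * I) φ (ω₁ * r) N f G (ω₁ * a + ω₂ * b) (ω₁ * a - ω₂ * b) with hR
  have hcL' : Continuous fun p : ℝ × ℝ => L p.1 p.2 := hcL
  have hcR' : Continuous fun p : ℝ × ℝ => R p.1 p.2 := hcR
  have pL : ∀ a b, L (a + 1) b = L a b := by
    intro a b
    simp only [hL]
    rw [← (hpL (ω₁ * a + ω₂ * b) (ω₁ * a - ω₂ * b)).1]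
    push_cast
    congr 1 <;> ring
  have pR : ∀ a b, R (a + 1) b = R a b := by
    intro a b
    simp only [hR]
    rw [← (hpR (ω₁ * a + ω₂ * b) (ω₁ * a - ω₂ * b)).1]
    push_cast
    congr 1 <;> ring
  obtain ⟨q, hq, hqY, hq1, hq2, hq3⟩ := sk_q t ht h hε h1 h2 σ hσ2 hσ ((N + 2) * (ω₁ * r))
  set J : ℝ → ℝ → ℂ := fun a b => L (a - r/2) b + σ * R (a + r/2) b with hJ
  set k := skk (t * I) (ω₁ * r) N f G q with hk
  have hkω : ∀ s z, k s (z + ω₂) = k s z := by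
    rcases hω.right with rfl | rfl
    · exact skk_one hτ _ hf hG hq1
    · exact skk_tau hτ _ hf hG hq2
  have hJk : ∀ a b : ℝ, J a b = k (ω₁ * a) (ω₂ * b + ω₁ * r / 2) := by
    intro a b
    have := skJ_eq (f := f) (G := G) (φ := φ) (N := N) hτ σ (ω₁ * r) (ω₁ * a) (ω₂ * b + ω₁ * r / 2)
      (q (ω₁ * a) (2 * (ω₂ * b + ω₁ * r / 2))) (hqY _ _) (by
        have := skp_ne_A ht hω r (2 * a) (N + 3)
        convert this using 2
        push_cast; ring) (by
        have := skp_ne_B ht hω r (2 * b) 0 (N + 2) (by push_cast; rw [abs_zero]; linarith)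
        convert this using 2
        push_cast; ring)
    simp only [hk, skk]
    rw [← this]
    simp only [hJ, hL, hR]
    rw [show ω₁ * ((a - r/2 : ℝ) : ℂ) + ω₂ * b = ω₁ * a + (ω₂ * b + ω₁ * r / 2 - ω₁ * r / 2) - ω₁ * r / 2 by push_cast; ring,
      show ω₁ * ((a - r/2 : ℝ) : ℂ) - ω₂ * b = ω₁ * a - (ω₂ * b + ω₁ * r / 2 - ω₁ * r / 2) - ω₁ * r / 2 by push_cast; ring,
      show ω₁ * ((a + r/2 : ℝ) : ℂ) + ω₂ * b = ω₁ * a + (ω₂ * b + ω₁ * r / 2 - ω₁ * r / 2) + ω₁ * r / 2 by push_cast; ring,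
      show ω₁ * ((a + r/2 : ℝ) : ℂ) - ω₂ * b = ω₁ * a - (ω₂ * b + ω₁ * r / 2 - ω₁ * r / 2) + ω₁ * r / 2 by push_cast; ring]
  set A : ℝ → ℂ := fun a => ∫ b in (0:ℝ)..1, J a b with hA
  have hA1 : ∀ a, A a = ∫ b in (0:ℝ)..1, k (ω₁ * a) (ω₂ * b) := by
    intro a
    obtain ⟨κ, hκ, hrot⟩ := sk_geo_rot ht hω
    have := sk_shift (fun ζ => k (ω₁ * a) (ω₂ * ζ)) (κ * r / 2) (by
      intro z
      rw [mul_add, mul_one, hkω]) (by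
      intro b s hs
      have hs' : |s| ≤ |κ * r / 2| := by
        rw [Set.mem_uIcc] at hs
        rcases hs with ⟨h1, h2⟩ | ⟨h1, h2⟩
        · rw [abs_of_nonneg h1]; exact h2.trans (le_abs_self _)
        · rw [abs_of_nonpos h2]
          exact (neg_le_neg h1).trans (neg_le_abs _)
      have hs2 : |2 * (s / κ)| ≤ |r| := by
        rw [abs_mul, abs_div, abs_two]
        rw [abs_div, abs_mul, abs_two] at hs'
        have : 0 < |κ| := abs_pos.2 hκ
        rw [← mul_div_assoc, div_le_iff₀ this]
        linarith
      have hne := skp_ne_B ht hω r (2 * b) (2 * (s / κ)) (N + 1) (by push_cast; linarith)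
      have hfd := hf.1
      have hGd := hG.1
      have hqd := hq (ω₁ * a)
      have hpd := skp_diff hτ (ω₁ * r) (N + 1)
      simp only [hk, skk]
      refine DifferentiableAt.div (by fun_prop) (by fun_prop) (mul_ne_zero ?_ ?_)
      · have := skp_ne_A ht hω r (2 * a) (N + 3)
        convert this using 2
        push_cast; ring
      · convert hne using 2
        have hκ' : (κ : ℂ) ≠ 0 := by exact_mod_cast hκ
        push_cast
        rw [hrot]
        field_simp)
    rw [this]
    simp only [hA]
    congr 1
    funext b
    rw [hJk]
    congr 1
    push_cast
    rw [hrot]; ring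
  have hAneg : ∀ a, A (-a) = - A a := by
    intro a
    rw [hA1, hA1]
    have e1 : ∫ b in (0:ℝ)..1, k (ω₁ * (-a : ℝ)) (ω₂ * b) =
        ∫ b in (0:ℝ)..1, k (ω₁ * (-a : ℝ)) (ω₂ * ((1 - b : ℝ) : ℂ)) := by
      rw [intervalIntegral.integral_comp_sub_left (fun b : ℝ => k (ω₁ * (-a : ℝ)) (ω₂ * b))]
      simp
    rw [e1, ← intervalIntegral.integral_neg]
    congr 1
    funext b
    rw [show (ω₂ * ((1 - b : ℝ) : ℂ)) = -(ω₂ * b) + ω₂ by push_cast; ring, hkω,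
      show (ω₁ * ((-a : ℝ) : ℂ)) = -(ω₁ * a) by push_cast; ring]
    exact skk_neg hτ _ hf hG hq3 _ _
  have hJ1 : ∀ a b, J (a + 1) b = J a b := by
    intro a b
    simp only [hJ]
    rw [show a + 1 - r/2 = a - r/2 + 1 by ring, pL, show a + 1 + r/2 = a + r/2 + 1 by ring, pR]
  have hAone : ∀ a, A (a + 1) = A a := by
    intro a
    simp only [hA, hJ1]
  have hA0 : ∫ a in (0:ℝ)..1, A a = 0 := by
    have e1 : ∫ a in (0:ℝ)..1, A a = ∫ a in (0:ℝ)..1, A (1 - a) := by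
      rw [intervalIntegral.integral_comp_sub_left]
      simp
    have e2 : ∫ a in (0:ℝ)..1, A (1 - a) = - ∫ a in (0:ℝ)..1, A a := by
      rw [← intervalIntegral.integral_neg]
      congr 1
      funext a
      rw [show 1 - a = -a + 1 by ring, hAone, hAneg]
    linear_combination (e1 + e2) / 2
  exact sk_abs L R σ r hcL' hcR' pL pR hA0

end

lemma sk_theta_conj (t : ℝ) (x : ℂ) :
    (starRingEnd ℂ) (θf (t * I) x) = θf (t * I) ((starRingEnd ℂ) x) := by
  rw [sk_theta_eq, sk_theta_eq]
  simp only [map_mul, jacobiTheta₂_conj, ← Complex.exp_conj, map_sub, map_add, map_div₀, conj_I,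
    conj_ofReal, map_one, map_ofNat]
  generalize (starRingEnd ℂ) x = z
  have h := jacobiTheta₂_add_left' (z + 1/2 - t * I / 2) (t * I)
  rw [show z + 1/2 - t * -I / 2 = z + 1/2 - t * I / 2 + t * I by ring,
    show -(t * -I) = (t * I : ℂ) by ring, h]
  have e : cexp (π * -I * (t * -I) / 4 - π * -I * z) * cexp (-π * I * (t * I + 2 * (z + 1/2 - t * I / 2)))
      = - cexp (π * I * (t * I) / 4 - π * I * z) := by
    rw [← Complex.exp_add]
    apply sk_exp_neg _ _ (-1)
    push_cast; ring
  linear_combination (-I) * jacobiTheta₂ (z + 1/2 - t * I / 2) (t * I) * e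

lemma sk_exp_sub_half_pi : cexp (-(π * I / 2)) = -I := by
  rw [show -(π * I / 2) = (-(π / 2 * I) : ℂ) by ring, Complex.exp_neg, Complex.exp_pi_div_two_mul_I, inv_I]

lemma sk_W_conj (t : ℝ) (x : ℂ) :
    (starRingEnd ℂ) (skW (t * I) x) = skW (t * I) ((starRingEnd ℂ) x) := by
  rw [sk_W_j, sk_W_j]
  simp only [sub_eq_add_neg, Complex.exp_add, sk_exp_sub_half_pi]
  simp only [map_mul, jacobiTheta₂_conj, ← Complex.exp_conj, map_neg, map_div₀, conj_I,
    conj_ofReal, map_ofNat]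
  rw [show -(t * -I) = (t * I : ℂ) by ring,
    show -(π * -I * (t * -I) / 4) = (-(π * I * (t * I) / 4) : ℂ) by ring]
  ring

/-- constants in `sfun` -/
def skγ (τ : ℂ) (i : Fin 4) : ℂ :=
  if i = 0 then 1 else if i = 1 then 1 else if i = 2 then cexp (π * I * (1/2 + τ/2))
  else - cexp (π * I * (τ/2))

lemma sk_sfun_eq (τ η : ℂ) (i : Fin 4) (x : ℂ) :
    sfun τ η i x = skγ τ i * skφ τ i η * skφ τ i (2 * x) := by
  fin_cases i
  · simp [sfun, skγ, skφ]
  · simp [sfun, skγ, skφ]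
  · have e : cexp (cπ*I*(1/2 + τ/2 + η + 2*x)) =
        cexp (π * I * (1/2 + τ/2)) * cexp (π * I * η) * cexp (π * I * (2 * x)) := by
      rw [← Complex.exp_add, ← Complex.exp_add]; congr 1; unfold cπ; ring
    have h1 : sfun τ η 2 x = cexp (cπ*I*(1/2 + τ/2 + η + 2*x)) * θf τ (η + 1/2 + τ/2) *
      θf τ (2*x + 1/2 + τ/2) := rfl
    have h2 : skγ τ 2 = cexp (π * I * (1/2 + τ/2)) := rfl
    have h3 : ∀ y, skφ τ 2 y = cexp (π * I * y) * θf τ (y + 1/2 + τ/2) := fun y => rfl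
    show sfun τ η 2 x = skγ τ 2 * skφ τ 2 η * skφ τ 2 (2 * x)
    rw [h1, h2, h3, h3, e]; ring
  · have e : cexp (cπ*I*(τ/2 + η + 2*x)) =
        cexp (π * I * (τ/2)) * cexp (π * I * η) * cexp (π * I * (2 * x)) := by
      rw [← Complex.exp_add, ← Complex.exp_add]; congr 1; unfold cπ; ring
    have h1 : sfun τ η 3 x = -cexp (cπ*I*(τ/2 + η + 2*x)) * θf τ (η + τ/2) *
      θf τ (2*x + τ/2) := rfl
    have h2 : skγ τ 3 = -cexp (π * I * (τ/2)) := rfl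
    have h3 : ∀ y, skφ τ 3 y = cexp (π * I * y) * θf τ (y + τ/2) := fun y => rfl
    show sfun τ η 3 x = skγ τ 3 * skφ τ 3 η * skφ τ 3 (2 * x)
    rw [h1, h2, h3, h3, e]; ring

lemma sk_sfun_conj (t : ℝ) (ht : 0 < t) (η : ℂ) (i : Fin 4) (x : ℂ) :
    (starRingEnd ℂ) (sfun (t * I) η i x) =
      skσ i * sfun (t * I) ((starRingEnd ℂ) η) i ((starRingEnd ℂ) x) := by
  have hτ : 0 < (t * I : ℂ).im := by simpa using ht
  rw [sk_sfun_eq, sk_sfun_eq, map_mul, map_mul]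
  rw [show 2 * (starRingEnd ℂ) x = (starRingEnd ℂ) (2 * x) by simp [map_ofNat]]
  generalize 2 * x = y
  have er : (starRingEnd ℂ) (cexp (π * I * (t * I / 2))) = cexp (π * I * (t * I / 2)) := by
    rw [← Complex.exp_conj]; congr 1; simp [map_ofNat]; ring
  fin_cases i
  · simp [skγ, skφ, skσ, sk_theta_conj, map_ofNat]
  · simp [skγ, skφ, skσ, sk_theta_conj, map_ofNat]
  · have h2 : skγ (t * I) 2 = I * cexp (π * I * (t * I / 2)) := by
      show cexp (π * I * (1/2 + t * I/2)) = _
      rw [mul_add, Complex.exp_add, show (π * I * (1/2) : ℂ) = π / 2 * I by ring,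
        Complex.exp_pi_div_two_mul_I]
    have h3 : ∀ y, skφ (t * I) 2 y = skW (t * I) y := fun y => rfl
    have h4 : skσ 2 = -1 := rfl
    show (starRingEnd ℂ) (skγ (t * I) 2) * (starRingEnd ℂ) (skφ (t * I) 2 η) *
      (starRingEnd ℂ) (skφ (t * I) 2 y) = skσ 2 * (skγ (t * I) 2 * skφ (t * I) 2 _ * skφ (t * I) 2 _)
    rw [h2, h3, h3, h3, h3, h4, sk_W_conj, sk_W_conj, map_mul, er, conj_I]; ring
  · have h2 : skγ (t * I) 3 = -cexp (π * I * (t * I / 2)) := rfl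
    have h3 : ∀ y, (starRingEnd ℂ) (skφ (t * I) 3 y) = - skφ (t * I) 3 ((starRingEnd ℂ) y) := by
      intro y
      show (starRingEnd ℂ) (cexp (π * I * y) * θf (t * I) (y + t * I/2)) =
        - (cexp (π * I * (starRingEnd ℂ) y) * θf (t * I) ((starRingEnd ℂ) y + t * I/2))
      rw [map_mul, sk_theta_conj, ← Complex.exp_conj]
      simp only [map_mul, map_add, conj_I, conj_ofReal, map_div₀, map_ofNat]
      generalize (starRingEnd ℂ) y = z
      rw [show z + t * -I / 2 = z + t * I / 2 - t * I by ring, sk_theta_sub_tau _ hτ]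
      have e : cexp (π * -I * z) * cexp (2 * π * I * (z + t * I / 2) - π * I * (t * I)) =
          cexp (π * I * z) := by rw [← Complex.exp_add]; congr 1; ring
      linear_combination -θf (t * I) (z + t * I / 2) * e
    have h4 : skσ 3 = 1 := rfl
    show (starRingEnd ℂ) (skγ (t * I) 3) * (starRingEnd ℂ) (skφ (t * I) 3 η) *
      (starRingEnd ℂ) (skφ (t * I) 3 y) = skσ 3 * (skγ (t * I) 3 * skφ (t * I) 3 _ * skφ (t * I) 3 _)
    rw [h2, h3, h3, h4, map_neg, er]; ring

/-- conjugate function -/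
def skG (g : ℂ → ℂ) (z : ℂ) : ℂ := (starRingEnd ℂ) (g ((starRingEnd ℂ) z))

lemma skG_sp {t : ℝ} {N : ℕ} {g : ℂ → ℂ} (hg : ThetaSp (t * I) N g) : ThetaSp (t * I) N (skG g) := by
  refine ⟨?_, ?_, ?_, ?_⟩
  · intro x
    have := (hg.1 ((starRingEnd ℂ) x)).conj_conj
    rw [Complex.conj_conj] at this
    exact this
  · intro x; simp only [skG, map_add, map_one, hg.2.1]
  · intro x
    have h := hg.sub_tau ((starRingEnd ℂ) x)
    simp only [skG]
    rw [show (starRingEnd ℂ) (x + t * I) = (starRingEnd ℂ) x - t * I by simp [sub_eq_add_neg], h, map_mul,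
      ← Complex.exp_conj]
    congr 2
    simp [cπ, map_ofNat]
    ring
  · intro x; simp only [skG, map_neg, hg.2.2.2]

lemma sk_Mw_eq (τ η : ℂ) (N : ℕ) (u v : ℂ) :
    Mw τ η N u v = θf τ (2*u) * θf τ (2*v) / (skp τ η (N+2) (u+v) * skp τ η (N+2) (u-v)) := by
  unfold Mw
  congr 1
  have e := sk_prod_E τ (-η) (-u - τ/2) (N+1) (N+2)
  rw [show -(((N + 2 : ℕ) : ℂ) * (2 * π * I * (-u - τ/2) + π * I * τ)) -
    2 * π * I * (-η) * (((N + 2 : ℕ) : ℂ) * (((N + 2 : ℕ) : ℂ) - 1) - ((N + 2 : ℕ) : ℂ) * (N + 1)) =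
    2*cπ*I*u*(N+2) by unfold cπ; push_cast; ring] at e
  rw [← e]
  unfold skp
  rw [← Finset.prod_mul_distrib, ← Finset.prod_mul_distrib]
  apply Finset.prod_congr rfl
  intro k hk
  have e2 : skE τ (-u - τ/2 + (2 * (k:ℂ) - (N+1)) * -η) =
      cexp (π * I * (u + v + (2 * (k:ℂ) - ((N + 2 : ℕ) - 1)) * η)) *
      cexp (π * I * (u - v + (2 * (k:ℂ) - ((N + 2 : ℕ) - 1)) * η)) := by
    unfold skE
    rw [← Complex.exp_add]; congr 1; push_cast; ring
  unfold skW
  rw [e2, show (2 * (k:ℂ) - N - 1) = (2 * (k:ℂ) - ((N + 2 : ℕ) - 1)) by push_cast; ring]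
  ring

section
variable {t : ℝ} {N : ℕ} {f g Sf Sg : ℂ → ℂ} {η : ℂ} {i : Fin 4}

lemma sk_intL (ht : 0 < t) (hf : ThetaSp (t * I) N f) (hg : ThetaSp (t * I) N g)
    (hSfEq : ∀ x, θf (t * I) (2*x) * Sf x = SRHS (t * I) η N i f x) (u : ℂ) :
    Sf u * (starRingEnd ℂ) (g u) * Mw (t * I) η N u ((starRingEnd ℂ) u) =
    skγ (t * I) i * skφ (t * I) i η *
      (skLL (t * I) (skφ (t * I) i) η N f (skG g) u ((starRingEnd ℂ) u) +
       skLL (t * I) (skφ (t * I) i) η N f (skG g) (-u) (-(starRingEnd ℂ) u)) := by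
  have hτ : 0 < (t * I : ℂ).im := by simpa using ht
  have hG : (starRingEnd ℂ) (g u) = skG g ((starRingEnd ℂ) u) := by simp [skG]
  have hG2 := (skG_sp hg).2.2.2 ((starRingEnd ℂ) u)
  rw [hG, sk_Mw_eq]
  have h := hSfEq u
  unfold SRHS at h
  rw [sk_sfun_eq, sk_sfun_eq] at h
  unfold skLL
  generalize (starRingEnd ℂ) u = v at *
  rw [hG2, show -u + -v = -(u + v) by ring, show -u - -v = -(u - v) by ring, skp_neg hτ, skp_neg hτ,
    mul_neg, mul_neg, (sk_theta_Q _ hτ).neg, show -u + η = -(u - η) by ring, hf.2.2.2,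
    ← mul_div_assoc, ← add_div, ← mul_div_assoc]
  rw [show 2 * (u - N * η / 2) = 2 * u - N * η by ring,
    show 2 * (-u - N * η / 2) = -(2 * u) - N * η by ring] at h
  congr 1
  linear_combination skG g v * θf (t * I) (2 * v) * h

lemma sk_intR (ht : 0 < t) (hf : ThetaSp (t * I) N f) (hg : ThetaSp (t * I) N g) (s : ℂ)
    (hs : (s = 1 ∧ (starRingEnd ℂ) η = η) ∨ (s = -1 ∧ (starRingEnd ℂ) η = -η))
    (hSgEq : ∀ x, θf (t * I) (2*x) * Sg x = SRHS (t * I) η N i g x) (u : ℂ) :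
    f u * (starRingEnd ℂ) (Sg u) * Mw (t * I) η N u ((starRingEnd ℂ) u) =
    -(s * skσ i * (skγ (t * I) i * skφ (t * I) i η)) *
      (skRR (t * I) (skφ (t * I) i) η N f (skG g) u ((starRingEnd ℂ) u) +
       skRR (t * I) (skφ (t * I) i) η N f (skG g) (-u) (-(starRingEnd ℂ) u)) := by
  have hτ : 0 < (t * I : ℂ).im := by simpa using ht
  have hφ := sk_φ_Q _ hτ i
  obtain ⟨hε, -, -, -, -⟩ := sk_signs i
  have hGn := (skG_sp hg).2.2.2
  have h := congrArg (starRingEnd ℂ) (hSgEq u)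
  unfold SRHS at h
  rw [map_mul, map_sub, map_mul, map_mul, sk_theta_conj, sk_sfun_conj t ht, sk_sfun_conj t ht] at h
  rw [show (starRingEnd ℂ) (g (u + η)) = skG g ((starRingEnd ℂ) u + (starRingEnd ℂ) η) by simp [skG],
    show (starRingEnd ℂ) (g (u - η)) = skG g ((starRingEnd ℂ) u - (starRingEnd ℂ) η) by simp [skG],
    show (starRingEnd ℂ) (2 * u) = 2 * (starRingEnd ℂ) u by simp [map_ofNat],
    show (starRingEnd ℂ) (u - N * η / 2) = (starRingEnd ℂ) u - N * (starRingEnd ℂ) η / 2 by simp [map_ofNat],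
    show (starRingEnd ℂ) (-u - N * η / 2) = -(starRingEnd ℂ) u - N * (starRingEnd ℂ) η / 2 by simp [map_ofNat],
    sk_sfun_eq, sk_sfun_eq] at h
  have h' : θf (t * I) (2 * (starRingEnd ℂ) u) * (starRingEnd ℂ) (Sg u) =
      s * skσ i * (skγ (t * I) i * skφ (t * I) i η) *
      (skφ (t * I) i (2 * (starRingEnd ℂ) u - N * η) * skG g ((starRingEnd ℂ) u + η) -
       skφ (t * I) i (-2 * (starRingEnd ℂ) u - N * η) * skG g ((starRingEnd ℂ) u - η)) := by
    rw [h]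
    generalize (starRingEnd ℂ) u = v
    rcases hs with ⟨rfl, e⟩ | ⟨rfl, e⟩
    · rw [e, show 2 * (v - N * η / 2) = 2 * v - N * η by ring,
        show 2 * (-v - N * η / 2) = -2 * v - N * η by ring]
      ring
    · rw [e, hφ.neg, hφ.neg' (show 2 * (v - N * -η / 2) = -(-2 * v - N * η) by ring),
        hφ.neg' (show 2 * (-v - N * -η / 2) = -(2 * v - N * η) by ring), sub_neg_eq_add,
        ← sub_eq_add_neg]
      linear_combination (skσ i * (skγ (t * I) i * skφ (t * I) i η) *
        (skφ (t * I) i (-2 * v - N * η) * skG g (v - η) -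
        skφ (t * I) i (2 * v - N * η) * skG g (v + η))) * hε
  clear h
  rw [sk_Mw_eq]
  unfold skRR
  generalize (starRingEnd ℂ) u = v at *
  rw [show -u + -v = -(u + v) by ring, show -u - -v = -(u - v) by ring, skp_neg hτ, skp_neg hτ,
    mul_neg 2 u, (sk_theta_Q _ hτ).neg, show -v - η = -(v + η) by ring, hf.2.2.2, hGn,
    ← mul_div_assoc, ← add_div, ← mul_div_assoc, show -2 * -v = 2 * v by ring]
  congr 1
  linear_combination f u * θf (t * I) (2 * u) * h'

end

section
variable {t : ℝ} {φ : ℂ → ℂ} {ε ρ₁ ρ₂ : ℂ} {N : ℕ} {f G : ℂ → ℂ} {ω₁ ω₂ : ℂ}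

lemma sk_sum (H : ℝ → ℝ → ℂ) (hH : Continuous fun p : ℝ × ℝ => H p.1 p.2) :
    ∫ b in (0:ℝ)..1, ∫ a in (0:ℝ)..1, (H a b + H (1 - a) (1 - b)) =
    2 * ∫ b in (0:ℝ)..1, ∫ a in (0:ℝ)..1, H a b := by
  have inner : ∀ b : ℝ, ∫ a in (0:ℝ)..1, (H a b + H (1 - a) (1 - b)) =
      (∫ a in (0:ℝ)..1, H a b) + ∫ a in (0:ℝ)..1, H a (1 - b) := by
    intro b
    have c1 : Continuous fun a : ℝ => H a b :=
      hH.comp (show Continuous fun a : ℝ => (a, b) by fun_prop)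
    have c2 : Continuous fun a : ℝ => H (1 - a) (1 - b) :=
      hH.comp (show Continuous fun a : ℝ => (1 - a, 1 - b) by fun_prop)
    rw [intervalIntegral.integral_add (c1.intervalIntegrable _ _) (c2.intervalIntegrable _ _),
      intervalIntegral.integral_comp_sub_left (fun a => H a (1 - b))]
    simp
  have c3 : Continuous fun b : ℝ => ∫ a in (0:ℝ)..1, H a b :=
    intervalIntegral.continuous_parametric_intervalIntegral_of_continuous'
      (f := fun b a => H a b) (hH.comp continuous_swap) 0 1
  have c4 : Continuous fun b : ℝ => ∫ a in (0:ℝ)..1, H a (1 - b) :=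
    c3.comp (show Continuous fun b : ℝ => 1 - b by fun_prop)
  simp only [inner]
  rw [intervalIntegral.integral_add (c3.intervalIntegrable _ _) (c4.intervalIntegrable _ _),
    intervalIntegral.integral_comp_sub_left (fun b => ∫ a in (0:ℝ)..1, H a b)]
  simp
  ring

lemma sk_core_abs (L R : ℝ → ℝ → ℂ) (hL : Continuous fun p : ℝ × ℝ => L p.1 p.2)
    (hR : Continuous fun p : ℝ × ℝ => R p.1 p.2) (σ : ℂ)
    (core : ∫ b in (0:ℝ)..1, ∫ a in (0:ℝ)..1, L a b = -σ * ∫ b in (0:ℝ)..1, ∫ a in (0:ℝ)..1, R a b)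
    (LS RS : ℝ → ℝ → ℂ) (eL : LS = fun a b => L a b + L (1 - a) (1 - b))
    (eR : RS = fun a b => R a b + R (1 - a) (1 - b)) :
    (∫ b in (0:ℝ)..1, ∫ a in (0:ℝ)..1, LS a b = -σ * ∫ b in (0:ℝ)..1, ∫ a in (0:ℝ)..1, RS a b) ∧
    (∫ a in (0:ℝ)..1, ∫ b in (0:ℝ)..1, LS a b = -σ * ∫ a in (0:ℝ)..1, ∫ b in (0:ℝ)..1, RS a b) := by
  subst eL eR
  have first : (∫ b in (0:ℝ)..1, ∫ a in (0:ℝ)..1, (L a b + L (1 - a) (1 - b)) =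
      -σ * ∫ b in (0:ℝ)..1, ∫ a in (0:ℝ)..1, (R a b + R (1 - a) (1 - b))) := by
    rw [sk_sum L hL, sk_sum R hR, core]; ring
  refine ⟨first, ?_⟩
  have c : ∀ H : ℝ → ℝ → ℂ, Continuous (fun p : ℝ × ℝ => H p.1 p.2) →
      Continuous (Function.uncurry fun a b => H a b + H (1 - a) (1 - b)) := by
    intro H hH
    exact hH.add (hH.comp (show Continuous fun p : ℝ × ℝ => (1 - p.1, 1 - p.2) by fun_prop))
  rw [← sk_swap _ (c L hL), ← sk_swap _ (c R hR)]
  exact first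

lemma sk_core2 (ht : 0 < t) (h : SkQ (t * I) φ ε ρ₁ ρ₂) (hε : ε ^ 2 = 1) (h1 : ρ₁ ^ 2 = 1)
    (h2 : ρ₂ ^ 2 = 1) (σ : ℂ) (hσ2 : σ ^ 2 = 1) (hσ : ρ₁ * ρ₂ = -(σ * ε))
    (hf : ThetaSp (t * I) N f) (hG : ThetaSp (t * I) N G) (hω : skOm t ω₁ ω₂) (r : ℝ)
    (hr : |r| < 1 / (2 * (N + 1))) (LS RS : ℝ → ℝ → ℂ)
    (hLS : ∀ a b, LS a b = skLL (t * I) φ (ω₁ * r) N f G (ω₁ * a + ω₂ * b) (ω₁ * a - ω₂ * b) +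
      skLL (t * I) φ (ω₁ * r) N f G (-(ω₁ * a + ω₂ * b)) (-(ω₁ * a - ω₂ * b)))
    (hRS : ∀ a b, RS a b = skRR (t * I) φ (ω₁ * r) N f G (ω₁ * a + ω₂ * b) (ω₁ * a - ω₂ * b) +
      skRR (t * I) φ (ω₁ * r) N f G (-(ω₁ * a + ω₂ * b)) (-(ω₁ * a - ω₂ * b))) :
    (∫ b in (0:ℝ)..1, ∫ a in (0:ℝ)..1, LS a b = -σ * ∫ b in (0:ℝ)..1, ∫ a in (0:ℝ)..1, RS a b) ∧
    (∫ a in (0:ℝ)..1, ∫ b in (0:ℝ)..1, LS a b = -σ * ∫ a in (0:ℝ)..1, ∫ b in (0:ℝ)..1, RS a b) := by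
  have core := sk_core ht h hε h1 h2 σ hσ2 hσ hf hG hω r hr
  have hcL := skLL_cont ht h hf hG hω r hr
  have hcR := skRR_cont ht h hf hG hω r hr
  have eL : LS = fun a b => (fun a b : ℝ => skLL (t * I) φ (ω₁ * r) N f G (ω₁ * a + ω₂ * b) (ω₁ * a - ω₂ * b)) a b
      + (fun a b : ℝ => skLL (t * I) φ (ω₁ * r) N f G (ω₁ * a + ω₂ * b) (ω₁ * a - ω₂ * b)) (1 - a) (1 - b) := by
    funext a b
    rw [hLS]
    congr 1
    rw [← (skLL_per ht h h1 h2 (ω₁ * r) hf hG ω₁ hω.left _ _).1,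
      ← (skLL_per ht h h1 h2 (ω₁ * r) hf hG ω₂ hω.right _ _).2.1]
    push_cast
    congr 1 <;> ring
  have eR : RS = fun a b => (fun a b : ℝ => skRR (t * I) φ (ω₁ * r) N f G (ω₁ * a + ω₂ * b) (ω₁ * a - ω₂ * b)) a b
      + (fun a b : ℝ => skRR (t * I) φ (ω₁ * r) N f G (ω₁ * a + ω₂ * b) (ω₁ * a - ω₂ * b)) (1 - a) (1 - b) := by
    funext a b
    rw [hRS]
    congr 1
    rw [← (skRR_per ht h h1 h2 (ω₁ * r) hf hG ω₁ hω.left _ _).1,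
      ← (skRR_per ht h h1 h2 (ω₁ * r) hf hG ω₂ hω.right _ _).2]
    push_cast
    congr 1 <;> ring
  clear hLS hRS
  exact sk_core_abs _ _ hcL hcR σ core LS RS eL eR

end

lemma sk_pairing_eq (t : ℝ) (η : ℂ) (N : ℕ) (f g : ℂ → ℂ) (F : ℂ → ℂ)
    (hF : ∀ u, f u * (starRingEnd ℂ) (g u) * Mw (t * I) η N u ((starRingEnd ℂ) u) = F u) :
    pairing (t * I) η t N f g =
      t * ∫ b in (0:ℝ)..1, ∫ a in (0:ℝ)..1, F (a + t * I * b) := by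
  unfold pairing
  simp only [hF]
  have := intervalIntegral.smul_integral_comp_mul_left (a := 0) (b := 1)
    (fun y : ℝ => ∫ x in (0:ℝ)..1, F (x + y * I)) t
  rw [mul_zero, mul_one] at this
  rw [← this, Complex.real_smul]
  congr 3
  funext b
  congr 1
  funext a
  congr 1
  push_cast; ring

section
variable {t : ℝ} {φ : ℂ → ℂ} {ε ρ₁ ρ₂ : ℂ} {N : ℕ} {f G : ℂ → ℂ}

lemma skLL_neg_v (hτ : 0 < (t * I : ℂ).im) (hG : ThetaSp (t * I) N G) (η u v : ℂ) :
    skLL (t * I) φ η N f G u (-v) = - skLL (t * I) φ η N f G u v := by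
  unfold skLL
  rw [hG.2.2.2, mul_neg 2 v, (sk_theta_Q _ hτ).neg, sub_neg_eq_add, ← sub_eq_add_neg]
  ring

lemma skRR_neg_v (hτ : 0 < (t * I : ℂ).im) (hf : ThetaSp (t * I) N f) (η u v : ℂ) :
    skRR (t * I) φ η N f G u (-v) = - skRR (t * I) φ η N f G (-u) (-v) := by
  unfold skRR
  rw [hf.2.2.2, mul_neg 2 u, (sk_theta_Q _ hτ).neg, show -u + -v = -(u + v) by ring,
    show -u - -v = -(u - v) by ring, skp_neg hτ, skp_neg hτ, sub_neg_eq_add, ← sub_eq_add_neg]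
  ring

end

lemma sk_real {t : ℝ} (ht : 0 < t) {N : ℕ} {i : Fin 4} {f g Sf Sg : ℂ → ℂ} {η : ℂ}
    (hf : ThetaSp (t * I) N f) (hg : ThetaSp (t * I) N g)
    (hSfEq : ∀ x, θf (t * I) (2*x) * Sf x = SRHS (t * I) η N i f x)
    (hSgEq : ∀ x, θf (t * I) (2*x) * Sg x = SRHS (t * I) η N i g x)
    (r : ℝ) (hη : η = r) (hr : |r| < 1 / (2 * (N + 1))) :
    pairing (t * I) η t N Sf g = pairing (t * I) η t N f Sg := by
  have hτ : 0 < (t * I : ℂ).im := by simpa using ht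
  obtain ⟨hε, hσ2, h1, h2, hσ⟩ := sk_signs i
  have hcore := (sk_core2 ht (sk_φ_Q _ hτ i) hε h1 h2 (skσ i) hσ2 hσ hf (skG_sp hg)
    (Or.inl ⟨rfl, rfl⟩) r hr _ _ (fun a b => rfl) (fun a b => rfl)).1
  have hR := sk_intR ht hf hg 1 (Or.inl ⟨rfl, by rw [hη, conj_ofReal]⟩) hSgEq
  rw [sk_pairing_eq t η N Sf g _ (sk_intL ht hf hg hSfEq), sk_pairing_eq t η N f Sg _ hR]
  have cj : ∀ a b : ℝ, (starRingEnd ℂ) (a + t * I * b) = 1 * (a : ℂ) - t * I * b := by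
    intro a b; simp; ring
  simp only [intervalIntegral.integral_const_mul, cj]
  simp only [hη]
  simp only [one_mul] at hcore ⊢
  rw [hcore]
  ring

lemma sk_imag {t : ℝ} (ht : 0 < t) {N : ℕ} {i : Fin 4} {f g Sf Sg : ℂ → ℂ} {η : ℂ}
    (hf : ThetaSp (t * I) N f) (hg : ThetaSp (t * I) N g)
    (hSfEq : ∀ x, θf (t * I) (2*x) * Sf x = SRHS (t * I) η N i f x)
    (hSgEq : ∀ x, θf (t * I) (2*x) * Sg x = SRHS (t * I) η N i g x)
    (r : ℝ) (hη : η = t * I * r) (hr : |r| < 1 / (2 * (N + 1))) :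
    pairing (t * I) η t N Sf g = - pairing (t * I) η t N f Sg := by
  have hτ : 0 < (t * I : ℂ).im := by simpa using ht
  obtain ⟨hε, hσ2, h1, h2, hσ⟩ := sk_signs i
  have hcore := (sk_core2 ht (sk_φ_Q _ hτ i) hε h1 h2 (skσ i) hσ2 hσ hf (skG_sp hg)
    (Or.inr ⟨rfl, rfl⟩) r hr _ _ (fun a b => rfl) (fun a b => rfl)).2
  have hL : ∀ u, Sf u * (starRingEnd ℂ) (g u) * Mw (t * I) η N u ((starRingEnd ℂ) u) =
    -(skγ (t * I) i * skφ (t * I) i η) *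
      (skLL (t * I) (skφ (t * I) i) η N f (skG g) u (-(starRingEnd ℂ) u) +
       skLL (t * I) (skφ (t * I) i) η N f (skG g) (-u) (-(-(starRingEnd ℂ) u))) := by
    intro u
    rw [sk_intL ht hf hg hSfEq, skLL_neg_v hτ (skG_sp hg) _ _ (-(starRingEnd ℂ) u),
      skLL_neg_v hτ (skG_sp hg) _ u, skLL_neg_v hτ (skG_sp hg) _ (-u)]
    ring
  have hR : ∀ u, f u * (starRingEnd ℂ) (Sg u) * Mw (t * I) η N u ((starRingEnd ℂ) u) =
    -(skσ i * (skγ (t * I) i * skφ (t * I) i η)) *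
      (skRR (t * I) (skφ (t * I) i) η N f (skG g) u (-(starRingEnd ℂ) u) +
       skRR (t * I) (skφ (t * I) i) η N f (skG g) (-u) (-(-(starRingEnd ℂ) u))) := by
    intro u
    rw [sk_intR ht hf hg (-1) (Or.inr ⟨rfl, by rw [hη]; simp⟩) hSgEq]
    have e1 := skRR_neg_v (φ := skφ (t * I) i) (G := skG g) hτ hf η u ((starRingEnd ℂ) u)
    have e2 := skRR_neg_v (φ := skφ (t * I) i) (G := skG g) hτ hf η (-u) (-(starRingEnd ℂ) u)
    rw [neg_neg, neg_neg] at e2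
    rw [neg_neg, e1, e2]
    ring
  rw [sk_pairing_eq t η N Sf g _ hL, sk_pairing_eq t η N f Sg _ hR]
  have cj : ∀ a b : ℝ, -(starRingEnd ℂ) (a + t * I * b) = t * I * b - 1 * (a : ℂ) := by
    intro a b; simp; ring
  have cu : ∀ a b : ℝ, (a + t * I * b : ℂ) = t * I * b + 1 * (a : ℂ) := by
    intro a b; ring
  simp only [intervalIntegral.integral_const_mul, cj]
  simp only [cu, hη]
  rw [hcore]
  ring

/-- For η ∈ ℝ_N, each Sklyanin operator S_i is self-adjoint for the
Sklyanin pairing; for η ∈ 𝕀_N, each S_i is skew-adjoint. -/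
theorem sklyanin_generators_adjoint
    (t : ℝ) (ht : 0 < t) (τ : ℂ) (hτ : τ = t * I)
    (N : ℕ) (η : ℂ) (i : Fin 4)
    (f g : ℂ → ℂ) (hf : ThetaSp τ N f) (hg : ThetaSp τ N g)
    (Sf : ℂ → ℂ) (hSf : Differentiable ℂ Sf)
    (hSfEq : ∀ x, θf τ (2*x) * Sf x = SRHS τ η N i f x)
    (Sg : ℂ → ℂ) (hSg : Differentiable ℂ Sg)
    (hSgEq : ∀ x, θf τ (2*x) * Sg x = SRHS τ η N i g x) :
    ((∃ r : ℝ, η = (r : ℂ) ∧ |r| < 1 / (2 * (N + 1))) →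
      pairing τ η t N Sf g = pairing τ η t N f Sg) ∧
    ((∃ s : ℝ, η = (s : ℂ) * I ∧ |s| < t / (2 * (N + 1))) →
      pairing τ η t N Sf g = - pairing τ η t N f Sg) := by
  subst hτ
  constructor
  · rintro ⟨r, hη, hr⟩
    exact sk_real ht hf hg hSfEq hSgEq r hη hr
  · rintro ⟨s, hη, hs⟩
    have ht' : (t : ℂ) ≠ 0 := by exact_mod_cast ht.ne'
    refine sk_imag ht hf hg hSfEq hSgEq (s / t) ?_ ?_
    · rw [hη]; push_cast; field_simp
    · rw [abs_div, abs_of_pos ht, div_lt_iff₀ ht]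
      calc |s| < t / (2 * (N + 1)) := hs
        _ = 1 / (2 * (N + 1)) * t := by ring
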